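/- arXiv:1602.08563 — 3 statements merged into one kernel-verified Lean document; each statement's English description precedes it below -/
import Mathlib

section
/- There exists a universal constant c > 0 such that for every finite rooted tree T, every even integer α ≥ 1, all cache sizes k_ONL ≥ k_OPT ≥ 1, and every finite request sequence I, the algorithm TC with cache capacity k_ONL satisfies TC(I) ≤ c·h(T)·(k_ONL/(k_ONL − k_OPT + 1))·OPT(I) + c·h(T)·k_ONL·α, where OPT(I) is the minimum cost of serving I by an offline algorithm with cache size k_OPT. In particular, TC is O(h(T)·k_ONL/(k_ONL − k_OPT + 1))-competitive. -/
open scoped Classical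

/-!
Common setup for the online tree caching problem
(Bienkowski, Marcinkowski, Pacut, Schmid, Spyra, "Online Tree Caching").
-/

/-- A finite rooted tree on the vertex type `V`: every vertex has a parent,
the root is its own parent, and iterating `parent` from any vertex reaches the root. -/
structure RTree (V : Type) where
  root : V
  parent : V → V
  parent_root : parent root = root
  reaches_root : ∀ v : V, ∃ n : ℕ, parent^[n] v = root

namespace RTree

variable {V : Type}

/-- The subtree `T(u)`: `u` together with all its descendants. -/
def subtree (T : RTree V) (u : V) : Set V :=
  {v | ∃ n : ℕ, T.parent^[n] v = u}

/-- `C` is a subforest of `T`: with every node it contains the whole subtree below it. -/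
def Subforest (T : RTree V) (C : Set V) : Prop :=
  ∀ v ∈ C, T.subtree v ⊆ C

/-- `A` is a tree cap rooted at `v`: `A ⊆ T(v)`, `v ∈ A`, and `A` is closed under
taking the parent (towards `v`). -/
def TreeCap (T : RTree V) (v : V) (A : Set V) : Prop :=
  A ⊆ T.subtree v ∧ v ∈ A ∧ ∀ u ∈ A, u ≠ v → T.parent u ∈ A

/-- `X` is a valid positive changeset for the cache `C`. -/
def ValidPos (T : RTree V) (C X : Set V) : Prop :=
  X.Nonempty ∧ X ∩ C = ∅ ∧ T.Subforest (C ∪ X)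

/-- `X` is a valid negative changeset for the cache `C`. -/
def ValidNeg (T : RTree V) (C X : Set V) : Prop :=
  X.Nonempty ∧ X ⊆ C ∧ T.Subforest (C \ X)

/-- `X` is a valid changeset for the cache `C`. -/
def Valid (T : RTree V) (C X : Set V) : Prop :=
  T.ValidPos C X ∨ T.ValidNeg C X

/-- `w` is the root of a tree (connected component) of the subforest `C`. -/
def IsCompRoot (T : RTree V) (C : Set V) (w : V) : Prop :=
  w ∈ C ∧ (w = T.root ∨ T.parent w ∉ C)

/-- The depth of a node: its distance to the root. -/
noncomputable def depth [DecidableEq V] (T : RTree V) (v : V) : ℕ :=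
  Nat.find (T.reaches_root v)

/-- The height `h(T)` of the tree: its number of levels. -/
noncomputable def height [Fintype V] [DecidableEq V] (T : RTree V) : ℕ :=
  (Finset.univ.sup fun v => T.depth v) + 1

end RTree

/-- A request: a node together with a sign (`true` = positive, `false` = negative). -/
abbrev Request (V : Type) := V × Bool

/-- The request `r` incurs cost `1` when the cache is `C`
(a positive request to a non-cached node, or a negative request to a cached node). -/
def Costly {V : Type} (r : Request V) (C : Set V) : Prop :=
  (r.2 = true ∧ r.1 ∉ C) ∨ (r.2 = false ∧ r.1 ∈ C)

/-- The sum of the counters `f` over the set of nodes `A`. -/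
noncomputable def cntSum {V : Type} [Fintype V] (f : V → ℕ) (A : Set V) : ℕ :=
  ∑ v : V, A.indicator f v

/-- The number of nodes of a changeset (`0` for no changeset). -/
noncomputable def chgSize {V : Type} : Option (Set V) → ℕ
  | none => 0
  | some X => X.ncard

/-- One phase of the algorithm `TC` on the request sequence `req` (the request of
round `t ≥ 1` is `req t`), starting at time `0` with an empty cache.
`cache t` is the cache contents during round `t`; `cnt t` are the counter values just
after serving the request of round `t` (used for the decision at time `t`);
`chg t` is the changeset applied at time `t` (right after round `t`), if any. -/
structure TCPhase {V : Type} [Fintype V] [DecidableEq V]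
    (T : RTree V) (α : ℕ) (req : ℕ → Request V) where
  cache : ℕ → Set V
  cnt : ℕ → V → ℕ
  chg : ℕ → Option (Set V)
  cache_subforest : ∀ t, T.Subforest (cache t)
  cache_zero : cache 0 = ∅
  cnt_zero : ∀ v, cnt 0 v = 0
  cnt_rec : ∀ t v, cnt (t + 1) v =
    (if ∃ X, chg t = some X ∧ v ∈ X then 0 else cnt t v)
    + (if (req (t + 1)).1 = v ∧ Costly (req (t + 1)) (cache (t + 1)) then 1 else 0)
  step_some : ∀ t X, chg t = some X →
    T.Valid (cache t) X ∧
    X.ncard * α ≤ cntSum (cnt t) X ∧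
    (∀ Y, T.Valid (cache t) Y → X ⊂ Y → cntSum (cnt t) Y < Y.ncard * α) ∧
    cache (t + 1) = if T.ValidPos (cache t) X then cache t ∪ X else cache t \ X
  step_none : ∀ t, chg t = none →
    cache (t + 1) = cache t ∧
    ∀ X, T.Valid (cache t) X → cntSum (cnt t) X < X.ncard * α

namespace TCPhase

variable {V : Type} [Fintype V] [DecidableEq V]
  {T : RTree V} {α : ℕ} {req : ℕ → Request V}

/-- The counter values at time `t`, right after the cache change at time `t`
(counters of fetched/evicted nodes are reset to `0`). -/
noncomputable def cntPost (E : TCPhase T α req) (t : ℕ) (v : V) : ℕ :=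
  if ∃ X, E.chg t = some X ∧ v ∈ X then 0 else E.cnt t v

/-- `last_v(t)`: the last time strictly before `t` at which `v` changed its
cached/non-cached state (`0`, the beginning of the phase, if there is none). -/
noncomputable def lastChg (E : TCPhase T α req) (v : V) (t : ℕ) : ℕ :=
  ((Finset.range t).filter fun s => ¬ ((v ∈ E.cache s) ↔ v ∈ E.cache (s + 1))).sup id

/-- The slot `(v, r)` belongs to the field `F^t`. -/
def inField (E : TCPhase T α req) (t : ℕ) (v : V) (r : ℕ) : Prop :=
  ∃ X, E.chg t = some X ∧ v ∈ X ∧ E.lastChg v t < r ∧ r ≤ t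

/-- The number of requests of the sequence `ρ` lying in slots of `F^t_{≤ τ} ∩ D`. -/
noncomputable def fieldReqIn (E : TCPhase T α req) (ρ : ℕ → Request V)
    (t : ℕ) (D : Set V) (τ : ℕ) : ℕ :=
  ((Finset.Icc 1 t).filter fun r => r ≤ τ ∧ (ρ r).1 ∈ D ∧ E.inField t (ρ r).1 r).card

/-- `req(F^t)`: the number of requests of `ρ` in slots of the field `F^t`. -/
noncomputable def fieldReq (E : TCPhase T α req) (ρ : ℕ → Request V) (t : ℕ) : ℕ :=
  E.fieldReqIn ρ t Set.univ t

/-- `size(F^t_{≤ τ} ∩ D)`: the number of distinct nodes having a slot in `F^t_{≤ τ} ∩ D`. -/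
noncomputable def fieldSizeIn (E : TCPhase T α req) (t : ℕ) (D : Set V) (τ : ℕ) : ℕ :=
  (Finset.univ.filter fun v : V => v ∈ D ∧ ∃ r, r ≤ τ ∧ E.inField t v r).card

/-- The standing assumption: no positive requests are given to cached nodes and no
negative requests to non-cached ones (so every request incurs cost `1` for `TC`). -/
def GoodReq (E : TCPhase T α req) : Prop :=
  ∀ t, 1 ≤ t →
    ((req t).2 = true → (req t).1 ∉ E.cache t) ∧
    ((req t).2 = false → (req t).1 ∈ E.cache t)

/-- The phase consists of rounds `1, …, tEnd`: no cache of `TC` before time `tEnd`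
exceeds the capacity `kONL` (at time `tEnd` the triggered fetch, if any, is performed
even if it exceeds the capacity, and is followed by the final eviction). -/
def PhaseEnd (E : TCPhase T α req) (kONL tEnd : ℕ) : Prop :=
  ∀ t, t < tEnd → (E.cache (t + 1)).ncard ≤ kONL

/-- `k_P`: the number of nodes in `TC`'s cache at the end of the phase
(after the fetch at time `tEnd`, before the final eviction). -/
noncomputable def kP (E : TCPhase T α req) (tEnd : ℕ) : ℕ :=
  (E.cache (tEnd + 1)).ncard

/-- The phase ending at `tEnd` is finished: the fetch at time `tEnd` exceeded the
capacity `kONL`. -/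
def FinishedAt (E : TCPhase T α req) (kONL tEnd : ℕ) : Prop :=
  E.PhaseEnd kONL tEnd ∧ kONL < E.kP tEnd

/-- `size(𝓕)`: the total size of all fields of the phase. -/
noncomputable def sizeFields (E : TCPhase T α req) (tEnd : ℕ) : ℕ :=
  ∑ t ∈ Finset.Icc 1 tEnd, chgSize (E.chg t)

/-- `req(F^∞)`: the number of requests of the phase lying in slots of the open field
(slots covered by no field of the phase). -/
noncomputable def openReq (E : TCPhase T α req) (tEnd : ℕ) : ℕ :=
  ((Finset.Icc 1 tEnd).filter fun r => ∀ t, t ≤ tEnd → ¬ E.inField t (req r).1 r).card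

/-- `TC(P)`: the total cost paid by `TC` during the phase: serving the requests,
fetching/evicting the applied changesets (`α` per node), and the final eviction
(`α · k_P`) if the phase is finished. -/
noncomputable def tcCost (E : TCPhase T α req) (kONL tEnd : ℕ) : ℕ :=
  ((Finset.Icc 1 tEnd).filter fun r => Costly (req r) (E.cache r)).card
  + α * E.sizeFields tEnd
  + (if kONL < E.kP tEnd then α * E.kP tEnd else 0)

/-- The tree cap `Y` (rooted at `u`, inside the negative field `F^t`) is proper for
the request sequence `ρ`: it holds `req(F^t ∩ Y) = |Y| · α`, and `F^t_{≤ τ} ∩ D` is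
not over-requested for every tree cap `D ⊆ Y` rooted at `u` and every time `τ ≤ t`. -/
def Proper (E : TCPhase T α req) (ρ : ℕ → Request V) (t : ℕ) (u : V) (Y : Set V) : Prop :=
  E.fieldReqIn ρ t Y t = Y.ncard * α ∧
  ∀ (D : Set V) (τ : ℕ), T.TreeCap u D → D ⊆ Y → τ ≤ t →
    E.fieldReqIn ρ t D τ ≤ E.fieldSizeIn t D τ * α

end TCPhase

/-- `D` is a feasible cache schedule for an (offline) algorithm with cache size `k`:
at every time the cache is a subforest of `T` of at most `k` nodes. -/
def IsSchedule {V : Type} (T : RTree V) (k : ℕ) (D : ℕ → Set V) : Prop :=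
  ∀ t, T.Subforest (D t) ∧ (D t).ncard ≤ k

/-- The cost of serving the requests of rounds `a, …, b` of `ρ` when the cache during
round `r` is `D r`. -/
noncomputable def serveCost {V : Type} (ρ : ℕ → Request V) (D : ℕ → Set V) (a b : ℕ) : ℕ :=
  ((Finset.Icc a b).filter fun r => Costly (ρ r) (D r)).card

/-- The reorganization cost of the schedule `D` (`α` per fetched or evicted node) over
the times `a, …, b - 1` (the change at time `t` leads from `D t` to `D (t+1)`). -/
noncomputable def moveCost {V : Type} (α : ℕ) (D : ℕ → Set V) (a b : ℕ) : ℕ :=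
  α * ∑ t ∈ Finset.Ico a b, ((D (t + 1) \ D t).ncard + (D t \ D (t + 1)).ncard)

/-- `OPT`: the minimum cost of serving rounds `a, …, b` of `ρ` by an offline algorithm
with cache size `k` that may start with an arbitrary cache. -/
noncomputable def optCostFrom {V : Type} (T : RTree V) (α k : ℕ)
    (ρ : ℕ → Request V) (a b : ℕ) : ℕ :=
  sInf {n | ∃ D : ℕ → Set V, IsSchedule T k D ∧
    n = serveCost ρ D a b + moveCost α D a b}

/-- `OPT`: the minimum cost of serving rounds `1, …, b` of `ρ` by an offline algorithm
with cache size `k` that starts with the empty cache. -/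
noncomputable def optCostEmpty {V : Type} (T : RTree V) (α k : ℕ)
    (ρ : ℕ → Request V) (b : ℕ) : ℕ :=
  sInf {n | ∃ D : ℕ → Set V, IsSchedule T k D ∧ D 0 = ∅ ∧
    n = serveCost ρ D 1 b + moveCost α D 0 b}

/-- `ρ'` is obtained from `ρ` by legally shifting requests: signs are preserved, every
positive request is moved to a descendant of its node (or kept), and every negative
request is moved to an ancestor of its node (or kept). -/
def LegalShift {V : Type} (T : RTree V) (ρ ρ' : ℕ → Request V) : Prop :=
  ∀ t, (ρ' t).2 = (ρ t).2 ∧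
    ((ρ t).2 = true → (ρ' t).1 ∈ T.subtree (ρ t).1) ∧
    ((ρ t).2 = false → (ρ t).1 ∈ T.subtree (ρ' t).1)

/-- A full run of the algorithm `TC` with cache capacity `kONL` on the request
sequence `req`, including phase restarts: whenever the fetch of a saturated changeset
would exceed the capacity, `TC` instead evicts its whole cache and a new phase starts
(`newPhase t` holds, and all counters are reset). -/
structure TCRun {V : Type} [Fintype V] [DecidableEq V]
    (T : RTree V) (α kONL : ℕ) (req : ℕ → Request V) where
  cache : ℕ → Set V
  cnt : ℕ → V → ℕ
  chg : ℕ → Option (Set V)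
  newPhase : ℕ → Prop
  cache_subforest : ∀ t, T.Subforest (cache t)
  cache_zero : cache 0 = ∅
  cnt_zero : ∀ v, cnt 0 v = 0
  capacity : ∀ t, (cache t).ncard ≤ kONL
  cnt_rec : ∀ t v, cnt (t + 1) v =
    (if newPhase t ∨ ∃ X, chg t = some X ∧ v ∈ X then 0 else cnt t v)
    + (if (req (t + 1)).1 = v ∧ Costly (req (t + 1)) (cache (t + 1)) then 1 else 0)
  step_some : ∀ t X, chg t = some X →
    T.Valid (cache t) X ∧
    X.ncard * α ≤ cntSum (cnt t) X ∧
    (∀ Y, T.Valid (cache t) Y → X ⊂ Y → cntSum (cnt t) Y < Y.ncard * α) ∧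
    ((T.ValidPos (cache t) X ∧ (cache t ∪ X).ncard ≤ kONL ∧
        cache (t + 1) = cache t ∪ X ∧ ¬ newPhase t) ∨
     (T.ValidPos (cache t) X ∧ kONL < (cache t ∪ X).ncard ∧
        cache (t + 1) = ∅ ∧ newPhase t) ∨
     (T.ValidNeg (cache t) X ∧ cache (t + 1) = cache t \ X ∧ ¬ newPhase t))
  step_none : ∀ t, chg t = none →
    cache (t + 1) = cache t ∧ ¬ newPhase t ∧
    ∀ X, T.Valid (cache t) X → cntSum (cnt t) X < X.ncard * α

/-- `TC(I)`: the total cost paid by the run `E` of `TC` on the rounds `1, …, N`: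
serving the requests, plus `α` per fetched/evicted node (on a phase restart the whole
cache is evicted). -/
noncomputable def TCRun.cost {V : Type} [Fintype V] [DecidableEq V]
    {T : RTree V} {α kONL : ℕ} {req : ℕ → Request V}
    (E : TCRun T α kONL req) (N : ℕ) : ℕ :=
  ((Finset.Icc 1 N).filter fun r => Costly (req r) (E.cache r)).card
  + α * ∑ t ∈ Finset.Icc 1 N,
      (if E.newPhase t then (E.cache t).ncard else chgSize (E.chg t))

namespace RTree

variable {V : Type} (T : RTree V)

lemma mem_subtree_self (v : V) : v ∈ T.subtree v := ⟨0, rfl⟩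

lemma subtree_trans {u v w : V} (h₁ : u ∈ T.subtree v) (h₂ : v ∈ T.subtree w) :
    u ∈ T.subtree w := by
  obtain ⟨n, rfl⟩ := h₁
  obtain ⟨m, rfl⟩ := h₂
  exact ⟨m + n, Function.iterate_add_apply _ _ _ _⟩

lemma subtree_total {u v w : V} (h₁ : u ∈ T.subtree v) (h₂ : u ∈ T.subtree w) :
    v ∈ T.subtree w ∨ w ∈ T.subtree v := by
  obtain ⟨n, rfl⟩ := h₁
  obtain ⟨m, rfl⟩ := h₂
  rcases le_total n m with h | h
  · exact Or.inl ⟨m - n, by rw [← Function.iterate_add_apply, Nat.sub_add_cancel h]⟩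
  · exact Or.inr ⟨n - m, by rw [← Function.iterate_add_apply, Nat.sub_add_cancel h]⟩

lemma parent_iterate_root (n : ℕ) : T.parent^[n] T.root = T.root :=
  Function.iterate_fixed T.parent_root n

lemma card_ancestors_le_height [Fintype V] [DecidableEq V] (x : V) :
    (Finset.univ.filter fun v => x ∈ T.subtree v).card ≤ T.height := by
  have hsub : (Finset.univ.filter fun v => x ∈ T.subtree v) ⊆
      (Finset.range (T.depth x + 1)).image fun n => T.parent^[n] x := by
    intro v hv
    obtain ⟨n, rfl⟩ := (Finset.mem_filter.1 hv).2
    rw [Finset.mem_image]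
    by_cases hn : n ≤ T.depth x
    · exact ⟨n, by simpa [Nat.lt_succ_iff] using hn, rfl⟩
    · refine ⟨T.depth x, by simp, ?_⟩
      have hr : T.parent^[T.depth x] x = T.root := Nat.find_spec (T.reaches_root x)
      obtain ⟨k, rfl⟩ := Nat.exists_eq_add_of_le (le_of_not_ge hn)
      rw [add_comm, Function.iterate_add_apply, hr, parent_iterate_root]
  calc _ ≤ _ := Finset.card_le_card hsub
    _ ≤ T.depth x + 1 := Finset.card_image_le.trans (by simp)
    _ ≤ T.height := Nat.succ_le_succ (Finset.le_sup (f := T.depth) (Finset.mem_univ x))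

end RTree

section Counting

variable {ι : Type*} {Q : Finset ι} {f : ι → Finset ℕ} {A : Finset ℕ}

lemma sum_card_le_of_disjoint (hsub : ∀ i ∈ Q, f i ⊆ A)
    (hdisj : ∀ i ∈ Q, ∀ j ∈ Q, ∀ r, r ∈ f i → r ∈ f j → i = j) :
    ∑ i ∈ Q, (f i).card ≤ A.card := by
  rw [← Finset.card_biUnion]
  · exact Finset.card_le_card (Finset.biUnion_subset.2 hsub)
  · intro i hi j hj hij
    exact Finset.disjoint_left.2 fun r h₁ h₂ => hij (hdisj i hi j hj r h₁ h₂)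

lemma card_le_sum_of_cover (h : ∀ r ∈ A, ∃ i ∈ Q, r ∈ f i) :
    A.card ≤ ∑ i ∈ Q, (f i).card :=
  (Finset.card_le_card fun r hr => Finset.mem_biUnion.2 (h r hr)).trans Finset.card_biUnion_le

end Counting

section Periods

variable {V : Type}

/-- The node `v` stays outside the caches `C r, …, C t`. -/
def StaysOut (C : ℕ → Set V) (v : V) (r t : ℕ) : Prop :=
  ∀ τ, r ≤ τ → τ ≤ t → v ∉ C τ

/-- The node `v` stays inside the caches `C r, …, C t`. -/
def StaysIn (C : ℕ → Set V) (v : V) (r t : ℕ) : Prop :=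
  ∀ τ, r ≤ τ → τ ≤ t → v ∈ C τ

/-- The rounds after `s` and up to `t` with a positive request to `v`, in the current
period of `v` outside the cache. -/
noncomputable def posReqs (ρ : ℕ → Request V) (C : ℕ → Set V) (s t : ℕ) (v : V) : Finset ℕ :=
  (Finset.Ioc s t).filter fun r => ρ r = (v, true) ∧ StaysOut C v r t

/-- The rounds after `s` and up to `t` with a negative request to `v`, in the current
period of `v` inside the cache. -/
noncomputable def negReqs (ρ : ℕ → Request V) (C : ℕ → Set V) (s t : ℕ) (v : V) : Finset ℕ :=
  (Finset.Ioc s t).filter fun r => ρ r = (v, false) ∧ StaysIn C v r t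

/-- The nodes fetched at time `t`. -/
noncomputable def fetched [Fintype V] (C : ℕ → Set V) (t : ℕ) : Finset V :=
  Finset.univ.filter fun v => v ∉ C t ∧ v ∈ C (t + 1)

/-- The nodes evicted at time `t`. -/
noncomputable def evicted [Fintype V] (C : ℕ → Set V) (t : ℕ) : Finset V :=
  Finset.univ.filter fun v => v ∈ C t ∧ v ∉ C (t + 1)

/-- The properties of the caches `C` of `TC` in a phase with rounds `s + 1, …, e` that the
analysis depends on: no valid changeset is ever over-requested, and every applied changeset
is saturated. -/
structure IsPhase [Fintype V] (T : RTree V) (α : ℕ) (ρ : ℕ → Request V) (s e : ℕ)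
    (C : ℕ → Set V) : Prop where
  lt : s < e
  sub : ∀ t, T.Subforest (C t)
  init : C (s + 1) = ∅
  pos_le : ∀ t, s < t → t ≤ e → ∀ Y : Finset V, (∀ v ∈ Y, v ∉ C t) →
    (∀ v ∈ Y, ∀ x ∈ T.subtree v, x ∉ C t → x ∈ Y) →
    ∑ v ∈ Y, (posReqs ρ C s t v).card ≤ α * Y.card
  neg_le : ∀ t, s < t → t ≤ e → ∀ Y : Finset V, (∀ v ∈ Y, v ∈ C t) →
    (∀ v ∈ Y, ∀ x ∈ C t, v ∈ T.subtree x → x ∈ Y) →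
    ∑ v ∈ Y, (negReqs ρ C s t v).card ≤ α * Y.card
  pos_sat : ∀ t, s < t → t < e →
    α * (fetched C t).card ≤ ∑ v ∈ fetched C t, (posReqs ρ C s t v).card
  neg_sat : ∀ t, s < t → t < e →
    α * (evicted C t).card ≤ ∑ v ∈ evicted C t, (negReqs ρ C s t v).card

variable {C D : ℕ → Set V} {ρ : ℕ → Request V} {s e t r : ℕ} {v x : V}

@[simp] lemma mem_posReqs :
    r ∈ posReqs ρ C s t v ↔ (s < r ∧ r ≤ t) ∧ ρ r = (v, true) ∧ StaysOut C v r t := by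
  simp [posReqs]

@[simp] lemma mem_negReqs :
    r ∈ negReqs ρ C s t v ↔ (s < r ∧ r ≤ t) ∧ ρ r = (v, false) ∧ StaysIn C v r t := by
  simp [negReqs]

@[simp] lemma mem_fetched [Fintype V] : v ∈ fetched C t ↔ v ∉ C t ∧ v ∈ C (t + 1) := by
  simp [fetched]

@[simp] lemma mem_evicted [Fintype V] : v ∈ evicted C t ↔ v ∈ C t ∧ v ∉ C (t + 1) := by
  simp [evicted]

lemma StaysOut.mono {r' t' : ℕ} (h : StaysOut C v r t) (hr : r ≤ r') (ht : t' ≤ t) :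
    StaysOut C v r' t' :=
  fun τ h₁ h₂ => h τ (hr.trans h₁) (h₂.trans ht)

lemma StaysIn.mono {r' t' : ℕ} (h : StaysIn C v r t) (hr : r ≤ r') (ht : t' ≤ t) :
    StaysIn C v r' t' :=
  fun τ h₁ h₂ => h τ (hr.trans h₁) (h₂.trans ht)

lemma StaysOut.eq_of_mem {t' : ℕ} (h : StaysOut C v r t) (h' : StaysOut C v r t')
    (hr : r ≤ t) (hr' : r ≤ t') (hv : v ∈ C (t + 1)) (hv' : v ∈ C (t' + 1)) : t = t' := by
  rcases lt_trichotomy t t' with hlt | rfl | hlt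
  · exact absurd hv (h' _ (by omega) hlt)
  · rfl
  · exact absurd hv' (h _ (by omega) hlt)

lemma StaysIn.eq_of_notMem {t' : ℕ} (h : StaysIn C v r t) (h' : StaysIn C v r t')
    (hr : r ≤ t) (hr' : r ≤ t') (hv : v ∉ C (t + 1)) (hv' : v ∉ C (t' + 1)) : t = t' := by
  rcases lt_trichotomy t t' with hlt | rfl | hlt
  · exact absurd (h' _ (by omega) hlt) hv
  · rfl
  · exact absurd (h _ (by omega) hlt) hv'

lemma exists_first {p : ℕ → Prop} (ht : r ≤ t) (h₁ : ¬ p r) (h₂ : p t) :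
    ∃ τ, r ≤ τ ∧ τ < t ∧ (∀ τ', r ≤ τ' → τ' ≤ τ → ¬ p τ') ∧ p (τ + 1) := by
  have hex : ∃ k, p (r + k) := ⟨t - r, by rwa [Nat.add_sub_cancel' ht]⟩
  have hspec := Nat.find_spec hex
  have hle : Nat.find hex ≤ t - r := Nat.find_min' hex (by rwa [Nat.add_sub_cancel' ht])
  have hne : Nat.find hex ≠ 0 := fun h => h₁ (by simpa [h] using hspec)
  refine ⟨r + Nat.find hex - 1, by omega, by omega, fun τ' ha hb hp => ?_, ?_⟩
  · refine Nat.find_min hex (m := τ' - r) (by omega) ?_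
    rwa [Nat.add_sub_cancel' ha]
  · rwa [show r + Nat.find hex - 1 + 1 = r + Nat.find hex by omega]

lemma staysOut_or_fetched (h : v ∉ C r) :
    StaysOut C v r t ∨ ∃ τ, r ≤ τ ∧ τ < t ∧ StaysOut C v r τ ∧ v ∈ C (τ + 1) := by
  by_contra! hc
  obtain ⟨h₁, h₂⟩ := hc
  simp only [StaysOut, not_forall, not_not] at h₁
  obtain ⟨τ, ha, hb, hv⟩ := h₁
  obtain ⟨τ', h₃, h₄, h₅, h₆⟩ := exists_first (p := fun τ => v ∈ C τ) ha h hv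
  exact h₂ τ' h₃ (by omega) h₅ h₆

lemma staysIn_or_evicted (h : v ∈ C r) :
    StaysIn C v r t ∨ ∃ τ, r ≤ τ ∧ τ < t ∧ StaysIn C v r τ ∧ v ∉ C (τ + 1) := by
  by_contra! hc
  obtain ⟨h₁, h₂⟩ := hc
  simp only [StaysIn, not_forall] at h₁
  obtain ⟨τ, ha, hb, hv⟩ := h₁
  obtain ⟨τ', h₃, h₄, h₅, h₆⟩ := exists_first (p := fun τ => v ∉ C τ) ha (not_not.2 h) hv
  exact h₆ (h₂ τ' h₃ (by omega) fun τ h₁ h₂ => not_not.1 (h₅ τ h₁ h₂))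

/-- Two finished periods outside the cache of the same node, each followed by a period inside
the cache that contains time `t`, coincide. -/
lemma outPeriod_unique {i j : Σ _ : ℕ, V} {t : ℕ} (hx : i.2 = j.2) (hi : i.2 ∉ C i.1)
    (hj : j.2 ∉ C j.1) (hit : i.1 ≤ t) (hjt : j.1 ≤ t)
    (h₁ : StaysIn C i.2 (i.1 + 1) t) (h₂ : StaysIn C j.2 (j.1 + 1) t) : i = j := by
  obtain ⟨t₁, x⟩ := i
  obtain ⟨t₂, y⟩ := j
  dsimp only at *
  subst hx
  rcases lt_trichotomy t₁ t₂ with hlt | rfl | hlt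
  · exact absurd (h₁ t₂ hlt hjt) hj
  · rfl
  · exact absurd (h₂ t₁ hlt hit) hi

end Periods

namespace IsPhase

variable {V : Type} [Fintype V] {T : RTree V} {α : ℕ} {ρ : ℕ → Request V}
  {s e : ℕ} {C D : ℕ → Set V}

/-- The evicted nodes that the schedule `D` keeps in its cache throughout the period in
which they are cached in `C`. -/
noncomputable def keptIn (C D : ℕ → Set V) (s t : ℕ) : Finset V :=
  (evicted C t).filter fun u => ∀ r, s < r → r ≤ t → StaysIn C u r t → u ∈ D r

/-- The negative requests to nodes evicted at time `t` that are costly for `D`. -/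
noncomputable def paidNeg (ρ : ℕ → Request V) (C D : ℕ → Set V) (s t : ℕ) : Finset ℕ :=
  (Finset.Ioc s t).filter fun r => ∃ v ∈ evicted C t, r ∈ negReqs ρ C s t v ∧ v ∈ D r

lemma keptIn_le_paidNeg (h : IsPhase T α ρ s e C) (hD : ∀ t, T.Subforest (D t))
    {t : ℕ} (hst : s < t) (hte : t < e) :
    α * (keptIn C D s t).card ≤ (paidNeg ρ C D s t).card := by
  set S := keptIn C D s t with hS
  set X := evicted C t with hX
  -- the nodes whose requests before `τ` cannot be charged to `S`
  let free : V → ℕ → Prop := fun v τ =>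
    s < τ ∧ τ ≤ t ∧ ∀ u ∈ S, v ∈ T.subtree u → ¬ StaysIn C u τ t
  let B : ℕ → Finset V := fun τ => X.filter fun v =>
    StaysIn C v τ t ∧ free v τ ∧ (τ < t → ¬ free v (τ + 1))
  have free_mono : ∀ v τ τ', free v τ' → s < τ → τ ≤ τ' → free v τ := by
    rintro v τ τ' ⟨h₁, h₂, h₃⟩ h₄ h₅
    exact ⟨h₄, h₅.trans h₂, fun u hu hv hin => h₃ u hu hv (hin.mono h₅ le_rfl)⟩
  have B_uniq : ∀ v τ τ', v ∈ B τ → v ∈ B τ' → τ ≤ τ' := by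
    intro v τ τ' h₁ h₂
    by_contra! hlt
    have hf := (Finset.mem_filter.1 h₁).2.2.1
    exact (Finset.mem_filter.1 h₂).2.2.2 (by have := hf.2.1; omega)
      (free_mono v _ _ hf (by have := (Finset.mem_filter.1 h₂).2.2.1.1; omega) hlt)
  have B_le : ∀ τ, s < τ → τ ≤ t →
      ∑ v ∈ B τ, (negReqs ρ C s τ v).card ≤ α * (B τ).card := by
    intro τ h₁ h₂
    refine h.neg_le τ h₁ (by omega) _ (fun v hv => ?_) (fun v hv x hx hvx => ?_)
    · exact (Finset.mem_filter.1 hv).2.1 τ le_rfl h₂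
    · obtain ⟨hvX, hvin, hvf, hvn⟩ := Finset.mem_filter.1 hv
      have hvt : v ∉ C (t + 1) := (mem_evicted.1 hvX).2
      have hxin : StaysIn C x τ t ∧ (τ < t → ¬ free x (τ + 1)) := by
        rcases h₂.eq_or_lt with rfl | hlt
        · exact ⟨fun τ' ha hb => by rwa [le_antisymm hb ha], fun h => absurd h (lt_irrefl _)⟩
        · have hn := hvn hlt
          simp only [free, not_and, not_forall, not_not] at hn
          obtain ⟨u, huS, hvu, huin⟩ := hn (by omega) hlt
          have huτ : u ∉ C τ := fun hu => hvf.2.2 u huS hvu fun τ' ha hb => by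
            rcases ha.eq_or_lt with rfl | ha
            · exact hu
            · exact huin τ' ha hb
          have hxu : x ∈ T.subtree u := (T.subtree_total hvx hvu).resolve_right
            fun hux => huτ (h.sub τ x hx hux)
          refine ⟨fun τ' ha hb => ?_, fun _ hf => hf.2.2 u huS hxu huin⟩
          rcases ha.eq_or_lt with rfl | ha
          · exact hx
          · exact h.sub τ' u (huin τ' ha hb) hxu
      refine Finset.mem_filter.2 ⟨?_, hxin.1, ⟨h₁, h₂, fun u hu hxu =>
        hvf.2.2 u hu (T.subtree_trans hvx hxu)⟩, hxin.2⟩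
      exact mem_evicted.2 ⟨hxin.1 t h₂ le_rfl, fun hx' => hvt (h.sub _ x hx' hvx)⟩
  have B_disj : ∀ τ v, v ∈ B τ → v ∈ X \ S := by
    intro τ v hv
    obtain ⟨hvX, hvin, hvf, -⟩ := Finset.mem_filter.1 hv
    exact Finset.mem_sdiff.2 ⟨hvX, fun hvS => hvf.2.2 v hvS (T.mem_subtree_self v) hvin⟩
  -- every unpaid request is counted in some `B τ`
  have hcover : (X.biUnion (negReqs ρ C s t) \ paidNeg ρ C D s t).card ≤
      ∑ i ∈ (Finset.Ioc s t).sigma B, (negReqs ρ C s i.1 i.2).card := by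
    refine card_le_sum_of_cover fun r hr => ?_
    obtain ⟨hr, hnp⟩ := Finset.mem_sdiff.1 hr
    obtain ⟨v, hvX, hr⟩ := Finset.mem_biUnion.1 hr
    have hr' := hr
    obtain ⟨⟨hsr, hrt⟩, hρ, hin⟩ := mem_negReqs.1 hr
    have hvD : v ∉ D r := fun hvD =>
      hnp (Finset.mem_filter.2 ⟨Finset.mem_Ioc.2 ⟨hsr, hrt⟩, v, hvX, hr, hvD⟩)
    have hfree : free v r := by
      refine ⟨hsr, hrt, fun u huS hvu huin => hvD ?_⟩
      exact hD r u ((Finset.mem_filter.1 huS).2 r hsr hrt huin) hvu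
    obtain ⟨τ, hrτ, hτt, hfτ, hnτ⟩ : ∃ τ, r ≤ τ ∧ τ ≤ t ∧ free v τ ∧
        (τ < t → ¬ free v (τ + 1)) := by
      by_cases hft : free v t
      · exact ⟨t, hrt, le_rfl, hft, fun h => absurd h (lt_irrefl _)⟩
      · obtain ⟨τ, ha, hb, hc, hd⟩ :=
          exists_first (p := fun τ => ¬ free v τ) hrt (not_not.2 hfree) hft
        exact ⟨τ, ha, hb.le, not_not.1 (hc τ ha le_rfl), fun _ => hd⟩
    refine ⟨⟨τ, v⟩, Finset.mem_sigma.2 ⟨Finset.mem_Ioc.2 ⟨hsr.trans_le hrτ, hτt⟩,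
      Finset.mem_filter.2 ⟨hvX, hin.mono hrτ le_rfl, hfτ, hnτ⟩⟩, ?_⟩
    exact mem_negReqs.2 ⟨⟨hsr, hrτ⟩, hρ, hin.mono le_rfl hτt⟩
  have hsum : ∑ i ∈ (Finset.Ioc s t).sigma B, (negReqs ρ C s i.1 i.2).card ≤
      α * (X \ S).card := by
    calc _ = ∑ τ ∈ Finset.Ioc s t, ∑ v ∈ B τ, (negReqs ρ C s τ v).card := Finset.sum_sigma _ _ _
      _ ≤ ∑ τ ∈ Finset.Ioc s t, α * (B τ).card := Finset.sum_le_sum fun τ hτ =>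
          B_le τ (Finset.mem_Ioc.1 hτ).1 (Finset.mem_Ioc.1 hτ).2
      _ = α * ((Finset.Ioc s t).biUnion B).card := by
          rw [← Finset.mul_sum, Finset.card_biUnion]
          intro τ _ τ' _ hne
          exact Finset.disjoint_left.2 fun v h₁ h₂ =>
            hne (le_antisymm (B_uniq v _ _ h₁ h₂) (B_uniq v _ _ h₂ h₁))
      _ ≤ _ := Nat.mul_le_mul_left _ (Finset.card_le_card
          (Finset.biUnion_subset.2 fun τ _ v hv => B_disj τ v hv))
  have htot : α * X.card ≤ (X.biUnion (negReqs ρ C s t)).card := by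
    refine (h.neg_sat t hst hte).trans (sum_card_le_of_disjoint
      (fun v hv => Finset.subset_biUnion_of_mem _ hv) fun v _ w _ r hv hw => ?_)
    have h₁ := (mem_negReqs.1 hv).2.1
    have h₂ := (mem_negReqs.1 hw).2.1
    simpa using h₁.symm.trans h₂
  have hSX : S ⊆ X := Finset.filter_subset _ _
  have h₁ := Finset.card_sdiff_add_card_eq_card hSX
  have h₂ := Finset.card_le_card_sdiff_add_card (s := X.biUnion (negReqs ρ C s t))
    (t := paidNeg ρ C D s t)
  have h₃ : α * X.card = α * (X \ S).card + α * S.card := by rw [← h₁, mul_add]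
  omega


/-- The positive requests to `v` that are assigned by `φ` to the period of `x` outside the
cache containing time `t`. -/
noncomputable def shifted (ρ : ℕ → Request V) (C : ℕ → Set V) (φ : ℕ → V) (s n t : ℕ)
    (v x : V) : Finset ℕ :=
  (Finset.Ioc s n).filter fun r =>
    ρ r = (v, true) ∧ φ r = x ∧ v ∉ C r ∧ StaysOut C x r t

/-- Positive requests can be shifted to non-cached descendants so that every period of a node
outside the cache receives at most `α` requests from each of its ancestors. -/
lemma exists_shift (h : IsPhase T α ρ s e C) (n : ℕ) (hn : n ≤ e) :
    ∃ φ : ℕ → V,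
      (∀ r, s < r → r ≤ n → (ρ r).2 = true → (ρ r).1 ∉ C r →
        φ r ∈ T.subtree (ρ r).1 ∧ φ r ∉ C r) ∧
      ∀ t, t ≤ n → ∀ v x, (shifted ρ C φ s t t v x).card ≤ α := by
  induction n with
  | zero =>
    refine ⟨fun _ => T.root, fun r h₁ h₂ => by omega, fun t ht v x => ?_⟩
    obtain rfl : t = 0 := by omega
    simp [shifted]
  | succ n ih =>
    obtain ⟨φ, hφ₁, hφ₂⟩ := ih (by omega)
    by_cases hcase : s < n + 1 ∧ (ρ (n + 1)).2 = true ∧ (ρ (n + 1)).1 ∉ C (n + 1)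
    swap
    · refine ⟨φ, fun r h₁ h₂ h₃ h₄ => ?_, fun t ht v x => ?_⟩
      · rcases h₂.eq_or_lt with rfl | h₂
        · exact absurd ⟨h₁, h₃, h₄⟩ hcase
        · exact hφ₁ r h₁ (by omega) h₃ h₄
      · rcases ht.eq_or_lt with rfl | ht
        · refine le_trans (Finset.card_le_card fun r hr => ?_) (hφ₂ n le_rfl v x)
          obtain ⟨hr, hρr, hφr, hv, hstay⟩ := Finset.mem_filter.1 hr
          rw [Finset.mem_Ioc] at hr
          have hrn : r ≠ n + 1 := by
            rintro rfl
            exact hcase ⟨hr.1, by rw [hρr], by rwa [hρr]⟩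
          exact Finset.mem_filter.2 ⟨Finset.mem_Ioc.2 ⟨hr.1, by omega⟩, hρr, hφr, hv,
            hstay.mono le_rfl (by omega)⟩
        · exact hφ₂ t (by omega) v x
    obtain ⟨hs, hpos, hout⟩ := hcase
    set w := (ρ (n + 1)).1 with hw
    have hρw : ρ (n + 1) = (w, true) := Prod.ext rfl hpos
    let P : Finset V := Finset.univ.filter fun x => x ∈ T.subtree w ∧ x ∉ C (n + 1)
    have hP : ∑ v ∈ P, (posReqs ρ C s (n + 1) v).card ≤ α * P.card := by
      refine h.pos_le (n + 1) hs hn P (fun v hv => (Finset.mem_filter.1 hv).2.2) ?_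
      intro v hv x hx hxC
      exact Finset.mem_filter.2 ⟨Finset.mem_univ _,
        T.subtree_trans hx (Finset.mem_filter.1 hv).2.1, hxC⟩
    have hwP : w ∈ P := Finset.mem_filter.2 ⟨Finset.mem_univ _, T.mem_subtree_self w, hout⟩
    have hw_le : (posReqs ρ C s (n + 1) w).card ≤ α * P.card :=
      (Finset.single_le_sum (f := fun v => (posReqs ρ C s (n + 1) v).card)
        (fun _ _ => Nat.zero_le _) hwP).trans hP
    obtain ⟨y, hyP, hy⟩ : ∃ y ∈ P, (shifted ρ C φ s n (n + 1) w y).card < α := by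
      by_contra! hc
      have h₁ : α * P.card ≤ ∑ y ∈ P, (shifted ρ C φ s n (n + 1) w y).card := by
        rw [mul_comm, ← smul_eq_mul]
        exact Finset.card_nsmul_le_sum _ _ _ hc
      have h₂ : ∑ y ∈ P, (shifted ρ C φ s n (n + 1) w y).card ≤
          ((posReqs ρ C s (n + 1) w).erase (n + 1)).card := by
        refine sum_card_le_of_disjoint (fun y hy r hr => ?_) fun y _ z _ r h₁ h₂ => ?_
        · obtain ⟨hr, hρr, -, -, hstay⟩ := Finset.mem_filter.1 hr
          rw [Finset.mem_Ioc] at hr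
          refine Finset.mem_erase.2 ⟨by omega, mem_posReqs.2 ⟨⟨hr.1, by omega⟩, hρr, ?_⟩⟩
          intro τ ha hb hwτ
          exact hstay τ ha hb (h.sub τ w hwτ (Finset.mem_filter.1 hy).2.1)
        · exact (Finset.mem_filter.1 h₁).2.2.1.symm.trans (Finset.mem_filter.1 h₂).2.2.1
      have hmem : n + 1 ∈ posReqs ρ C s (n + 1) w :=
        mem_posReqs.2 ⟨⟨hs, le_rfl⟩, hρw, fun τ ha hb => by rwa [le_antisymm hb ha]⟩
      have h₃ := Finset.card_erase_lt_of_mem hmem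
      omega
    obtain ⟨-, hyw, hyC⟩ := Finset.mem_filter.1 hyP
    refine ⟨Function.update φ (n + 1) y, fun r h₁ h₂ h₃ h₄ => ?_, fun t ht v x => ?_⟩
    · rcases h₂.eq_or_lt with rfl | h₂
      · simpa using ⟨hyw, hyC⟩
      · rw [Function.update_of_ne (by omega)]
        exact hφ₁ r h₁ (by omega) h₃ h₄
    · rcases ht.eq_or_lt with rfl | ht
      · by_cases hvx : v = w ∧ x = y
        · obtain ⟨rfl, rfl⟩ := hvx
          refine le_trans (Finset.card_le_card (t := insert (n + 1)
            (shifted ρ C φ s n (n + 1) w x)) fun r hr => ?_)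
            ((Finset.card_insert_le _ _).trans hy)
          obtain ⟨hr, hρr, hφr, hv, hstay⟩ := Finset.mem_filter.1 hr
          rw [Finset.mem_Ioc] at hr
          by_cases hrn : r = n + 1
          · exact Finset.mem_insert.2 (Or.inl hrn)
          · rw [Function.update_of_ne hrn] at hφr
            exact Finset.mem_insert.2 (Or.inr (Finset.mem_filter.2
              ⟨Finset.mem_Ioc.2 ⟨hr.1, by omega⟩, hρr, hφr, hv, hstay⟩))
        · refine le_trans (Finset.card_le_card fun r hr => ?_) (hφ₂ n le_rfl v x)
          obtain ⟨hr, hρr, hφr, hv, hstay⟩ := Finset.mem_filter.1 hr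
          rw [Finset.mem_Ioc] at hr
          by_cases hrn : r = n + 1
          · subst hrn
            rw [Function.update_self] at hφr
            exact absurd ⟨(Prod.ext_iff.1 hρr).1.symm, hφr.symm⟩ hvx
          · rw [Function.update_of_ne hrn] at hφr
            exact Finset.mem_filter.2 ⟨Finset.mem_Ioc.2 ⟨hr.1, by omega⟩, hρr, hφr,
              hv, hstay.mono le_rfl (by omega)⟩
      · refine le_trans (le_of_eq ?_) (hφ₂ t (by omega) v x)
        congr 1
        refine Finset.filter_congr fun r hr => ?_
        rw [Function.update_of_ne (by have := (Finset.mem_Ioc.1 hr).2; omega)]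

/-- The rounds in `s + 1, …, e` with a positive request that is costly for `D`. -/
noncomputable def posCost (ρ : ℕ → Request V) (D : ℕ → Set V) (s e : ℕ) : Finset ℕ :=
  (Finset.Ioc s e).filter fun r => (ρ r).2 = true ∧ (ρ r).1 ∉ D r

/-- The rounds in `s + 1, …, e` with a negative request that is costly for `D`. -/
noncomputable def negCost (ρ : ℕ → Request V) (D : ℕ → Set V) (s e : ℕ) : Finset ℕ :=
  (Finset.Ioc s e).filter fun r => (ρ r).2 = false ∧ (ρ r).1 ∈ D r

/-- The finished periods outside the cache, indexed by their last round and their node. -/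
noncomputable def outPeriods (C : ℕ → Set V) (s e : ℕ) : Finset (Σ _ : ℕ, V) :=
  (Finset.Ioo s e).sigma (fetched C)

/-- The positive requests assigned by `φ` to the period `i` outside the cache. -/
noncomputable def received (ρ : ℕ → Request V) (C : ℕ → Set V) (φ : ℕ → V) (s : ℕ)
    (i : Σ _ : ℕ, V) : Finset ℕ :=
  (Finset.Ioc s i.1).filter fun r =>
    (ρ r).2 = true ∧ (ρ r).1 ∉ C r ∧ φ r = i.2 ∧ StaysOut C i.2 r i.1

lemma mem_outPeriods {i : Σ _ : ℕ, V} :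
    i ∈ outPeriods C s e ↔ (s < i.1 ∧ i.1 < e) ∧ i.2 ∉ C i.1 ∧ i.2 ∈ C (i.1 + 1) := by
  simp [outPeriods]

lemma sum_keptIn_le (h : IsPhase T α ρ s e C) (hD : ∀ t, T.Subforest (D t)) :
    α * ((Finset.Ioo s e).sigma (keptIn C D s)).card ≤ (negCost ρ D s e).card := by
  rw [Finset.card_sigma, Finset.mul_sum]
  calc _ ≤ ∑ t ∈ Finset.Ioo s e, (paidNeg ρ C D s t).card := Finset.sum_le_sum fun t ht =>
        h.keptIn_le_paidNeg hD (Finset.mem_Ioo.1 ht).1 (Finset.mem_Ioo.1 ht).2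
    _ ≤ _ := by
      refine sum_card_le_of_disjoint (fun t ht r hr => ?_) fun t _ t' _ r h₁ h₂ => ?_
      · obtain ⟨hr, v, hv, hr', hvD⟩ := Finset.mem_filter.1 hr
        have hρ := (mem_negReqs.1 hr').2.1
        rw [Finset.mem_Ioc] at hr
        rw [Finset.mem_Ioo] at ht
        exact Finset.mem_filter.2 ⟨Finset.mem_Ioc.2 ⟨hr.1, by omega⟩, by rw [hρ], by rwa [hρ]⟩
      · obtain ⟨-, v, hv, hr, -⟩ := Finset.mem_filter.1 h₁
        obtain ⟨-, w, hw, hr', -⟩ := Finset.mem_filter.1 h₂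
        obtain ⟨⟨_, h₃⟩, h₄, h₅⟩ := mem_negReqs.1 hr
        obtain ⟨⟨_, h₆⟩, h₇, h₈⟩ := mem_negReqs.1 hr'
        obtain rfl : v = w := by simpa using h₄.symm.trans h₇
        exact h₅.eq_of_notMem h₈ h₃ h₆ (mem_evicted.1 hv).2 (mem_evicted.1 hw).2

lemma received_le {φ : ℕ → V} {n H : ℕ}
    (hH : ∀ x, (Finset.univ.filter fun v => x ∈ T.subtree v).card ≤ H)
    (hφ₁ : ∀ r, s < r → r ≤ n → (ρ r).2 = true → (ρ r).1 ∉ C r →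
      φ r ∈ T.subtree (ρ r).1 ∧ φ r ∉ C r)
    (hφ₂ : ∀ t, t ≤ n → ∀ v x, (shifted ρ C φ s t t v x).card ≤ α)
    (i : Σ _ : ℕ, V) (hi : i.1 ≤ n) :
    (received ρ C φ s i).card ≤ H * α := by
  calc (received ρ C φ s i).card
      ≤ ∑ v ∈ Finset.univ.filter (fun v => i.2 ∈ T.subtree v),
          (shifted ρ C φ s i.1 i.1 v i.2).card := by
        refine card_le_sum_of_cover fun r hr => ?_
        obtain ⟨hr, h₁, h₂, h₃, h₄⟩ := Finset.mem_filter.1 hr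
        have hr' := Finset.mem_Ioc.1 hr
        refine ⟨(ρ r).1, Finset.mem_filter.2 ⟨Finset.mem_univ _, ?_⟩,
          Finset.mem_filter.2 ⟨hr, Prod.ext rfl h₁, h₃, h₂, h₄⟩⟩
        rw [← h₃]
        exact (hφ₁ r hr'.1 (by omega) h₁ h₂).1
    _ ≤ ∑ v ∈ Finset.univ.filter (fun v => i.2 ∈ T.subtree v), α :=
        Finset.sum_le_sum fun v _ => hφ₂ _ hi _ _
    _ ≤ _ := by
        rw [Finset.sum_const, smul_eq_mul]
        exact Nat.mul_le_mul_right _ (hH _)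

lemma received_disjoint {φ : ℕ → V} {i j : Σ _ : ℕ, V} {r : ℕ}
    (hi : i ∈ outPeriods C s e) (hj : j ∈ outPeriods C s e)
    (h₁ : r ∈ received ρ C φ s i) (h₂ : r ∈ received ρ C φ s j) : i = j := by
  obtain ⟨hr, -, -, h₃, h₄⟩ := Finset.mem_filter.1 h₁
  obtain ⟨hr', -, -, h₅, h₆⟩ := Finset.mem_filter.1 h₂
  obtain ⟨t, x⟩ := i
  obtain ⟨t', x'⟩ := j
  obtain rfl : x = x' := h₃.symm.trans h₅
  have := h₄.eq_of_mem h₆ (Finset.mem_Ioc.1 hr).2 (Finset.mem_Ioc.1 hr').2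
    (mem_outPeriods.1 hi).2.2 (mem_outPeriods.1 hj).2.2
  simp only at this
  rw [this]

lemma le_sum_received (h : IsPhase T α ρ s e C) {φ : ℕ → V}
    (hφ₁ : ∀ r, s < r → r ≤ e → (ρ r).2 = true → (ρ r).1 ∉ C r →
      φ r ∈ T.subtree (ρ r).1 ∧ φ r ∉ C r) :
    α * (outPeriods C s e).card ≤ ∑ i ∈ outPeriods C s e, (received ρ C φ s i).card := by
  calc α * (outPeriods C s e).card
      ≤ ∑ i ∈ outPeriods C s e, (posReqs ρ C s i.1 i.2).card := by
        rw [outPeriods, Finset.card_sigma, Finset.mul_sum, Finset.sum_sigma]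
        exact Finset.sum_le_sum fun t ht =>
          h.pos_sat t (Finset.mem_Ioo.1 ht).1 (Finset.mem_Ioo.1 ht).2
    _ ≤ ((outPeriods C s e).biUnion fun i => posReqs ρ C s i.1 i.2).card := by
        refine sum_card_le_of_disjoint
          (fun i hi => Finset.subset_biUnion_of_mem (fun i => posReqs ρ C s i.1 i.2) hi)
          fun i hi j hj r h₁ h₂ => ?_
        obtain ⟨⟨_, h₃⟩, h₄, h₅⟩ := mem_posReqs.1 h₁
        obtain ⟨⟨_, h₆⟩, h₇, h₈⟩ := mem_posReqs.1 h₂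
        obtain ⟨t, x⟩ := i
        obtain ⟨t', x'⟩ := j
        obtain rfl : x = x' := by simpa using h₄.symm.trans h₇
        have := h₅.eq_of_mem h₈ h₃ h₆ (mem_outPeriods.1 hi).2.2 (mem_outPeriods.1 hj).2.2
        simp only at this
        rw [this]
    _ ≤ _ := by
        refine card_le_sum_of_cover fun r hr => ?_
        obtain ⟨⟨t, v⟩, hi, hr⟩ := Finset.mem_biUnion.1 hr
        obtain ⟨⟨hst, hte⟩, hv, hv'⟩ := mem_outPeriods.1 hi
        obtain ⟨⟨hsr, hrt⟩, hρ, hout⟩ := mem_posReqs.1 hr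
        dsimp only at *
        have hvr : v ∉ C r := hout r le_rfl hrt
        obtain ⟨hx, hxC⟩ := hφ₁ r hsr (by omega) (by rw [hρ]) (by rwa [hρ])
        rw [hρ] at hx
        obtain ⟨τ, h₁, h₂, h₃, h₄⟩ := (staysOut_or_fetched (C := C) (t := t + 1) hxC).resolve_left
          fun hstay => hstay (t + 1) (by omega) le_rfl (h.sub _ v hv' hx)
        refine ⟨⟨τ, φ r⟩, mem_outPeriods.2 ⟨⟨?_, ?_⟩, h₃ τ h₁ le_rfl, h₄⟩,
          Finset.mem_filter.2 ⟨Finset.mem_Ioc.2 ⟨hsr, h₁⟩, by rw [hρ], by rwa [hρ], rfl, h₃⟩⟩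
        · exact hsr.trans_le h₁
        · exact (Nat.lt_succ_iff.1 h₂).trans_lt hte

/-- The cost of the schedule `D` in rounds `s + 1, …, e`, with fetching and evicting between
these rounds. -/
noncomputable def phaseCost (α : ℕ) (ρ : ℕ → Request V) (D : ℕ → Set V) (s e : ℕ) : ℕ :=
  (posCost ρ D s e).card + (negCost ρ D s e).card +
    α * ∑ t ∈ Finset.Ioo s e, ((fetched D t).card + (evicted D t).card)

/-- The nodes in the set `A`. -/
noncomputable def nodes (A : Set V) : Finset V := Finset.univ.filter fun v => v ∈ A

@[simp] lemma mem_nodes {A : Set V} {v : V} : v ∈ nodes A ↔ v ∈ A := by simp [nodes]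

/-- Every well-requested period outside the cache that is followed by a finished period inside
the cache is paid for by `D`. -/
lemma card_fullPeriods_le (h : IsPhase T α ρ s e C) (hD : ∀ t, T.Subforest (D t))
    (φ : ℕ → V)
    (hφ₁ : ∀ r, s < r → r ≤ e → (ρ r).2 = true → (ρ r).1 ∉ C r →
      φ r ∈ T.subtree (ρ r).1 ∧ φ r ∉ C r) :
    α * ((outPeriods C s e).filter fun i => α ≤ 2 * (received ρ C φ s i).card).card ≤
      2 * phaseCost α ρ D s e + α * (nodes (C e)).card := by
  set F := (outPeriods C s e).filter fun i => α ≤ 2 * (received ρ C φ s i).card with hF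
  have memF : ∀ i ∈ F, ((s < i.1 ∧ i.1 < e) ∧ i.2 ∉ C i.1 ∧ i.2 ∈ C (i.1 + 1)) ∧
      α ≤ 2 * (received ρ C φ s i).card := fun i hi =>
    ⟨mem_outPeriods.1 (Finset.mem_filter.1 hi).1, (Finset.mem_filter.1 hi).2⟩
  let Fa := F.filter fun i => ∀ r, s < r → r ≤ i.1 → StaysOut C i.2 r i.1 → i.2 ∉ D r
  let Fb := F.filter fun i => ∃ t, i.1 < t ∧ t < e ∧ StaysIn C i.2 (i.1 + 1) t ∧
    i.2 ∈ keptIn C D s t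
  let Fc := F.filter fun i => ∃ τ, s < τ ∧ τ < e ∧ i.2 ∈ evicted D τ ∧
    (τ ≤ i.1 ∧ StaysOut C i.2 τ i.1 ∨ i.1 < τ ∧ StaysIn C i.2 (i.1 + 1) τ)
  let Fd := F.filter fun i => StaysIn C i.2 (i.1 + 1) e
  have hcover : F ⊆ Fa ∪ Fb ∪ Fc ∪ Fd := by
    intro i hi
    obtain ⟨⟨⟨hsi, hie⟩, hiC, hiC'⟩, -⟩ := memF i hi
    by_cases ha : i ∈ Fa
    · simp [ha]
    by_cases hb : i ∈ Fb
    · simp [hb]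
    by_cases hd : i ∈ Fd
    · simp [hd]
    have hstay : ¬ StaysIn C i.2 (i.1 + 1) e := fun hd' => hd (Finset.mem_filter.2 ⟨hi, hd'⟩)
    obtain ⟨t, h₁, h₂, h₃, h₄⟩ := (staysIn_or_evicted hiC').resolve_left hstay
    have ha' : ∃ r, s < r ∧ r ≤ i.1 ∧ StaysOut C i.2 r i.1 ∧ i.2 ∈ D r := by
      by_contra! hc
      exact ha (Finset.mem_filter.2 ⟨hi, hc⟩)
    obtain ⟨r₁, hr₁, hr₁', hout, hD₁⟩ := ha'
    have hb' : ∃ r, s < r ∧ r ≤ t ∧ StaysIn C i.2 r t ∧ i.2 ∉ D r := by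
      by_contra! hc
      exact hb (Finset.mem_filter.2 ⟨hi, t, h₁, h₂, h₃, Finset.mem_filter.2
        ⟨mem_evicted.2 ⟨h₃ t h₁ le_rfl, h₄⟩, hc⟩⟩)
    obtain ⟨r₂, hr₂, hr₂', hin, hD₂⟩ := hb'
    have hlt : i.1 < r₂ := by
      by_contra! hc
      exact hiC (hin i.1 hc (by omega))
    obtain ⟨τ, ht₁, ht₂, ht₃, ht₄⟩ := exists_first (p := fun r => i.2 ∉ D r)
      (by omega : r₁ ≤ r₂) (not_not.2 hD₁) hD₂
    have hc : i ∈ Fc := by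
      refine Finset.mem_filter.2 ⟨hi, τ, by omega, by omega,
        mem_evicted.2 ⟨not_not.1 (ht₃ τ ht₁ le_rfl), ht₄⟩, ?_⟩
      rcases le_or_gt τ i.1 with hle | hgt
      · exact Or.inl ⟨hle, hout.mono ht₁ le_rfl⟩
      · exact Or.inr ⟨hgt, h₃.mono le_rfl (by omega)⟩
    simp [hc]
  have hFa : α * Fa.card ≤ 2 * (posCost ρ D s e).card := by
    calc α * Fa.card ≤ ∑ i ∈ Fa, 2 * (received ρ C φ s i).card := by
          rw [mul_comm, ← smul_eq_mul]
          exact Finset.card_nsmul_le_sum _ _ _ fun i hi => (memF i (Finset.mem_filter.1 hi).1).2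
      _ = 2 * ∑ i ∈ Fa, (received ρ C φ s i).card := by rw [Finset.mul_sum]
      _ ≤ _ := by
        refine Nat.mul_le_mul_left _ (sum_card_le_of_disjoint (fun i hi r hr => ?_)
          fun i hi j hj r => received_disjoint
            (Finset.mem_filter.1 (Finset.mem_filter.1 hi).1).1
            (Finset.mem_filter.1 (Finset.mem_filter.1 hj).1).1)
        obtain ⟨hi, hiD⟩ := Finset.mem_filter.1 hi
        have hi' := (memF i hi).1.1
        obtain ⟨hr, h₁, h₂, h₃, h₄⟩ := Finset.mem_filter.1 hr
        rw [Finset.mem_Ioc] at hr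
        refine Finset.mem_filter.2 ⟨Finset.mem_Ioc.2 ⟨hr.1, by omega⟩, h₁, fun hrD => ?_⟩
        refine hiD r hr.1 hr.2 h₄ (hD r _ hrD ?_)
        rw [← h₃]
        exact (hφ₁ r hr.1 (by omega) h₁ h₂).1
  have hFb : α * Fb.card ≤ (negCost ρ D s e).card := by
    refine le_trans (Nat.mul_le_mul_left _ ?_) (h.sum_keptIn_le hD)
    refine Finset.card_le_card_of_forall_subsingleton
      (fun i j => i.2 = j.2 ∧ i.1 < j.1 ∧ StaysIn C i.2 (i.1 + 1) j.1) ?_ ?_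
    · intro i hi
      obtain ⟨hi, t, h₁, h₂, h₃, h₄⟩ := Finset.mem_filter.1 hi
      have hi' := (memF i hi).1.1
      exact ⟨⟨t, i.2⟩, Finset.mem_sigma.2 ⟨Finset.mem_Ioo.2 ⟨hi'.1.trans h₁, h₂⟩, h₄⟩, rfl, h₁, h₃⟩
    · rintro j - i ⟨hi, h₁, h₂, h₃⟩ i' ⟨hi', h₁', h₂', h₃'⟩
      exact outPeriod_unique (h₁.trans h₁'.symm) (memF i (Finset.mem_filter.1 hi).1).1.2.1
        (memF i' (Finset.mem_filter.1 hi').1).1.2.1 h₂.le h₂'.le h₃ h₃'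
  have hFc : Fc.card ≤ ∑ t ∈ Finset.Ioo s e, (evicted D t).card := by
    rw [← Finset.card_sigma]
    refine Finset.card_le_card_of_forall_subsingleton
      (fun i j => i.2 = j.2 ∧ (j.1 ≤ i.1 ∧ StaysOut C i.2 j.1 i.1 ∨
        i.1 < j.1 ∧ StaysIn C i.2 (i.1 + 1) j.1)) ?_ ?_
    · intro i hi
      obtain ⟨hi, τ, h₁, h₂, h₃, h₄⟩ := Finset.mem_filter.1 hi
      exact ⟨⟨τ, i.2⟩, Finset.mem_sigma.2 ⟨Finset.mem_Ioo.2 ⟨h₁, h₂⟩, h₃⟩, rfl, h₄⟩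
    · rintro ⟨τ, y⟩ - ⟨t, x⟩ ⟨hi, h₁, h₂⟩ ⟨t', x'⟩ ⟨hi', h₁', h₂'⟩
      have hx := (memF _ (Finset.mem_filter.1 hi).1).1.2
      have hx' := (memF _ (Finset.mem_filter.1 hi').1).1.2
      dsimp only at *
      subst h₁ h₁'
      rcases h₂ with ⟨ha, hb⟩ | ⟨ha, hb⟩ <;> rcases h₂' with ⟨hc, hd⟩ | ⟨hc, hd⟩
      · obtain rfl := hb.eq_of_mem hd ha hc hx.2 hx'.2
        rfl
      · exact absurd (hd τ hc le_rfl) (hb τ le_rfl ha)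
      · exact absurd (hb τ ha le_rfl) (hd τ le_rfl hc)
      · exact outPeriod_unique rfl hx.1 hx'.1 ha.le hc.le hb hd
  have hFd : Fd.card ≤ (nodes (C e)).card := by
    refine Finset.card_le_card_of_forall_subsingleton
      (fun i x => i.2 = x ∧ StaysIn C i.2 (i.1 + 1) e) ?_ ?_
    · intro i hi
      obtain ⟨hi, hd⟩ := Finset.mem_filter.1 hi
      have := (memF i hi).1.1.2
      exact ⟨i.2, mem_nodes.2 (hd e this le_rfl), rfl, hd⟩
    · rintro x - i ⟨hi, h₁, h₂⟩ i' ⟨hi', h₁', h₂'⟩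
      have hx := (memF _ (Finset.mem_filter.1 hi).1).1
      have hx' := (memF _ (Finset.mem_filter.1 hi').1).1
      exact outPeriod_unique (h₁.trans h₁'.symm) hx.2.1 hx'.2.1 hx.1.2.le hx'.1.2.le h₂ h₂'
  have hcard : F.card ≤ Fa.card + Fb.card + Fc.card + Fd.card := by
    have h₁ := Finset.card_le_card hcover
    have h₂ := Finset.card_union_le (Fa ∪ Fb ∪ Fc) Fd
    have h₃ := Finset.card_union_le (Fa ∪ Fb) Fc
    have h₄ := Finset.card_union_le Fa Fb
    omega
  have h₁ := Nat.mul_le_mul_left α hcard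
  have h₂ := Nat.mul_le_mul_left α hFc
  have h₃ := Nat.mul_le_mul_left α hFd
  have h₄ : α * ∑ t ∈ Finset.Ioo s e, (evicted D t).card ≤
      α * ∑ t ∈ Finset.Ioo s e, ((fetched D t).card + (evicted D t).card) :=
    Nat.mul_le_mul_left _ (Finset.sum_le_sum fun t _ => Nat.le_add_left _ _)
  simp only [mul_add] at h₁
  unfold phaseCost
  omega

/-- The total size of the fetches of a phase is bounded by the cost of any schedule. -/
lemma card_outPeriods_le (h : IsPhase T α ρ s e C) (hD : ∀ t, T.Subforest (D t)) {H : ℕ}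
    (hH : ∀ x, (Finset.univ.filter fun v => x ∈ T.subtree v).card ≤ H) :
    α * (outPeriods C s e).card ≤
      2 * H * (2 * phaseCost α ρ D s e + α * (nodes (C e)).card) := by
  obtain ⟨φ, hφ₁, hφ₂⟩ := h.exists_shift e le_rfl
  have hfull := h.card_fullPeriods_le hD φ hφ₁
  have hsum := h.le_sum_received hφ₁
  set F := (outPeriods C s e).filter fun i => α ≤ 2 * (received ρ C φ s i).card with hF
  have hsplit := Finset.sum_filter_add_sum_filter_not (outPeriods C s e)
    (fun i => α ≤ 2 * (received ρ C φ s i).card) fun i => 2 * (received ρ C φ s i).card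
  have h₁ : ∑ i ∈ F, 2 * (received ρ C φ s i).card ≤ F.card * (2 * (H * α)) := by
    rw [← smul_eq_mul]
    refine Finset.sum_le_card_nsmul _ _ _ fun i hi => Nat.mul_le_mul_left _ ?_
    exact received_le hH hφ₁ hφ₂ i (mem_outPeriods.1 (Finset.mem_filter.1 hi).1).1.2.le
  have h₂ : ∑ i ∈ (outPeriods C s e).filter fun i => ¬ α ≤ 2 * (received ρ C φ s i).card,
      2 * (received ρ C φ s i).card ≤ (outPeriods C s e).card * α := by
    rw [← smul_eq_mul]
    refine (Finset.sum_le_card_nsmul _ _ α fun i hi => ?_).trans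
      (Nat.mul_le_mul_right _ (Finset.card_le_card (Finset.filter_subset _ _)))
    exact (not_le.1 (Finset.mem_filter.1 hi).2).le
  have h₃ : ∑ i ∈ outPeriods C s e, 2 * (received ρ C φ s i).card =
      2 * ∑ i ∈ outPeriods C s e, (received ρ C φ s i).card := (Finset.mul_sum _ _ _).symm
  rw [h₃, ← hF] at hsplit
  have h₄ := Nat.mul_le_mul_left (2 * H) hfull
  linarith

lemma card_nodes_succ (C : ℕ → Set V) (t : ℕ) :
    (nodes (C (t + 1))).card + (evicted C t).card =
      (nodes (C t)).card + (fetched C t).card := by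
  rw [← Finset.card_union_of_disjoint, ← Finset.card_union_of_disjoint]
  · congr 1
    ext v
    simp only [Finset.mem_union, mem_nodes, mem_evicted, mem_fetched]
    tauto
  · exact Finset.disjoint_left.2 fun v h₁ h₂ => (mem_fetched.1 h₂).1 (mem_nodes.1 h₁)
  · exact Finset.disjoint_left.2 fun v h₁ h₂ => (mem_evicted.1 h₂).2 (mem_nodes.1 h₁)

lemma card_nodes_add_sum_evicted (C : ℕ → Set V) (hse : s < e) :
    (nodes (C e)).card + ∑ t ∈ Finset.Ioo s e, (evicted C t).card =
      (nodes (C (s + 1))).card + ∑ t ∈ Finset.Ioo s e, (fetched C t).card := by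
  induction e, hse using Nat.le_induction with
  | base =>
    have hIoo : Finset.Ioo s (s + 1) = ∅ := Finset.eq_empty_of_forall_notMem fun t ht => by
      rw [Finset.mem_Ioo] at ht
      omega
    simp [hIoo]
  | succ e hse ih =>
    have hIoo : Finset.Ioo s (e + 1) = insert e (Finset.Ioo s e) := by
      ext t
      simp only [Finset.mem_Ioo, Finset.mem_insert]
      omega
    rw [hIoo, Finset.sum_insert (by simp), Finset.sum_insert (by simp)]
    have := card_nodes_succ C e
    omega

/-- The nodes contained in one of the caches `D (s + 1), …, D e`. -/
noncomputable def visited (D : ℕ → Set V) (s e : ℕ) : Finset V :=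
  Finset.univ.filter fun v => ∃ r, (s < r ∧ r ≤ e) ∧ v ∈ D r

lemma mem_visited {v : V} : v ∈ visited D s e ↔ ∃ r, (s < r ∧ r ≤ e) ∧ v ∈ D r := by
  simp [visited]

lemma card_visited_le (D : ℕ → Set V) :
    (visited D s e).card ≤
      (nodes (D (s + 1))).card + ∑ t ∈ Finset.Ioo s e, (fetched D t).card := by
  have hsub : visited D s e ⊆ nodes (D (s + 1)) ∪ (Finset.Ioo s e).biUnion (fetched D) := by
    intro v hv
    obtain ⟨r, ⟨hr, hr'⟩, hvr⟩ := mem_visited.1 hv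
    by_cases hv' : v ∈ D (s + 1)
    · exact Finset.mem_union_left _ (mem_nodes.2 hv')
    obtain ⟨τ, h₁, h₂, h₃, h₄⟩ := exists_first (p := fun t => v ∈ D t) hr hv' hvr
    exact Finset.mem_union_right _ (Finset.mem_biUnion.2
      ⟨τ, Finset.mem_Ioo.2 ⟨h₁, by omega⟩, mem_fetched.2 ⟨h₃ τ h₁ le_rfl, h₄⟩⟩)
  exact (Finset.card_le_card hsub).trans
    ((Finset.card_union_le _ _).trans (Nat.add_le_add_left Finset.card_biUnion_le _))

lemma card_posCost_add_visited_le (D : ℕ → Set V) :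
    (posCost ρ D s e).card + α * (visited D s e).card ≤
      phaseCost α ρ D s e + α * (nodes (D (s + 1))).card := by
  have h₁ := Nat.mul_le_mul_left α (card_visited_le (s := s) (e := e) D)
  have h₂ : α * ∑ t ∈ Finset.Ioo s e, (fetched D t).card ≤
      α * ∑ t ∈ Finset.Ioo s e, ((fetched D t).card + (evicted D t).card) :=
    Nat.mul_le_mul_left _ (Finset.sum_le_sum fun t _ => Nat.le_add_right _ _)
  rw [mul_add] at h₁
  unfold phaseCost
  omega

lemma card_posCost_le (h : IsPhase T α ρ s e C) (hD : ∀ t, T.Subforest (D t)) :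
    (posCost ρ C s e).card ≤ α * ∑ t ∈ Finset.Ioo s e, (fetched C t).card +
      ((posCost ρ D s e).card + α * (visited D s e).card) := by
  let Z := (visited D s e).filter fun v => v ∉ C e
  have hcover : posCost ρ C s e ⊆
      ((outPeriods C s e).biUnion fun i => posReqs ρ C s i.1 i.2) ∪
        (posCost ρ D s e ∪ Z.biUnion (posReqs ρ C s e)) := by
    intro r hr
    obtain ⟨hr, h₁, h₂⟩ := Finset.mem_filter.1 hr
    have hr' := Finset.mem_Ioc.1 hr
    have hρ : ρ r = ((ρ r).1, true) := Prod.ext rfl h₁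
    rcases staysOut_or_fetched (t := e) h₂ with hout | ⟨τ, h₃, h₄, h₅, h₆⟩
    · refine Finset.mem_union_right _ ?_
      by_cases hrD : (ρ r).1 ∈ D r
      · refine Finset.mem_union_right _ (Finset.mem_biUnion.2 ⟨(ρ r).1, ?_, ?_⟩)
        · exact Finset.mem_filter.2 ⟨mem_visited.2 ⟨r, hr', hrD⟩, hout e hr'.2 le_rfl⟩
        · exact mem_posReqs.2 ⟨hr', hρ, hout⟩
      · exact Finset.mem_union_left _ (Finset.mem_filter.2 ⟨hr, h₁, hrD⟩)
    · refine Finset.mem_union_left _ (Finset.mem_biUnion.2 ⟨⟨τ, (ρ r).1⟩, ?_, ?_⟩)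
      · exact mem_outPeriods.2 ⟨⟨hr'.1.trans_le h₃, h₄⟩, h₅ τ h₃ le_rfl, h₆⟩
      · exact mem_posReqs.2 ⟨⟨hr'.1, h₃⟩, hρ, h₅⟩
  have h₁ : ∑ i ∈ outPeriods C s e, (posReqs ρ C s i.1 i.2).card ≤
      α * ∑ t ∈ Finset.Ioo s e, (fetched C t).card := by
    rw [outPeriods, Finset.mul_sum, Finset.sum_sigma]
    refine Finset.sum_le_sum fun t ht => ?_
    rw [Finset.mem_Ioo] at ht
    refine h.pos_le t ht.1 ht.2.le _ (fun v hv => (mem_fetched.1 hv).1) fun v hv x hx hxC => ?_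
    exact mem_fetched.2 ⟨hxC, h.sub _ v (mem_fetched.1 hv).2 hx⟩
  have h₂ : ∑ v ∈ Z, (posReqs ρ C s e v).card ≤ α * (visited D s e).card := by
    refine (h.pos_le e h.lt le_rfl Z (fun v hv => (Finset.mem_filter.1 hv).2)
      fun v hv x hx hxC => ?_).trans
      (Nat.mul_le_mul_left _ (Finset.card_le_card (Finset.filter_subset _ _)))
    obtain ⟨r, hr, hvr⟩ := mem_visited.1 (Finset.mem_filter.1 hv).1
    exact Finset.mem_filter.2 ⟨mem_visited.2 ⟨r, hr, hD r v hvr hx⟩, hxC⟩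
  refine (Finset.card_le_card hcover).trans ((Finset.card_union_le _ _).trans
    (Nat.add_le_add (Finset.card_biUnion_le.trans h₁) ((Finset.card_union_le _ _).trans
    (Nat.add_le_add_left (Finset.card_biUnion_le.trans h₂) _))))

lemma card_negCost_le (h : IsPhase T α ρ s e C) :
    (negCost ρ C s e).card ≤
      α * ∑ t ∈ Finset.Ioo s e, (evicted C t).card + α * (nodes (C e)).card := by
  have hcover : negCost ρ C s e ⊆
      (((Finset.Ioo s e).sigma (evicted C)).biUnion fun i => negReqs ρ C s i.1 i.2) ∪
        (nodes (C e)).biUnion (negReqs ρ C s e) := by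
    intro r hr
    obtain ⟨hr, h₁, h₂⟩ := Finset.mem_filter.1 hr
    have hr' := Finset.mem_Ioc.1 hr
    have hρ : ρ r = ((ρ r).1, false) := Prod.ext rfl h₁
    rcases staysIn_or_evicted (t := e) h₂ with hin | ⟨τ, h₃, h₄, h₅, h₆⟩
    · exact Finset.mem_union_right _ (Finset.mem_biUnion.2
        ⟨(ρ r).1, mem_nodes.2 (hin e hr'.2 le_rfl), mem_negReqs.2 ⟨hr', hρ, hin⟩⟩)
    · refine Finset.mem_union_left _ (Finset.mem_biUnion.2 ⟨⟨τ, (ρ r).1⟩, ?_, ?_⟩)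
      · exact Finset.mem_sigma.2 ⟨Finset.mem_Ioo.2 ⟨hr'.1.trans_le h₃, h₄⟩,
          mem_evicted.2 ⟨h₅ τ h₃ le_rfl, h₆⟩⟩
      · exact mem_negReqs.2 ⟨⟨hr'.1, h₃⟩, hρ, h₅⟩
  have h₁ : ∑ i ∈ (Finset.Ioo s e).sigma (evicted C), (negReqs ρ C s i.1 i.2).card ≤
      α * ∑ t ∈ Finset.Ioo s e, (evicted C t).card := by
    rw [Finset.mul_sum, Finset.sum_sigma]
    refine Finset.sum_le_sum fun t ht => ?_
    rw [Finset.mem_Ioo] at ht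
    refine h.neg_le t ht.1 ht.2.le _ (fun v hv => (mem_evicted.1 hv).1) fun v hv x hx hxC => ?_
    exact mem_evicted.2 ⟨hx, fun hx' => (mem_evicted.1 hv).2 (h.sub _ x hx' hxC)⟩
  have h₂ : ∑ v ∈ nodes (C e), (negReqs ρ C s e v).card ≤ α * (nodes (C e)).card :=
    h.neg_le e h.lt le_rfl _ (fun v hv => mem_nodes.1 hv) fun v hv x hx _ => mem_nodes.2 hx
  exact (Finset.card_le_card hcover).trans ((Finset.card_union_le _ _).trans
    (Nat.add_le_add (Finset.card_biUnion_le.trans h₁) (Finset.card_biUnion_le.trans h₂)))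

lemma sum_fetched_eq (C : ℕ → Set V) :
    ∑ t ∈ Finset.Ioo s e, (fetched C t).card = (outPeriods C s e).card := by
  rw [outPeriods, Finset.card_sigma]

lemma sum_evicted_le (h : IsPhase T α ρ s e C) :
    ∑ t ∈ Finset.Ioo s e, (evicted C t).card ≤ (outPeriods C s e).card := by
  have := card_nodes_add_sum_evicted C h.lt
  have h₀ : (nodes (C (s + 1))).card = 0 := by simp [nodes, h.init]
  rw [h₀, sum_fetched_eq] at this
  omega

/-- The cost of `TC` in a phase, including that of the changes of total size `n` in the last
step, which are either saturated or an eviction of the whole cache. -/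
lemma cost_le (h : IsPhase T α ρ s e C) (hD : ∀ t, T.Subforest (D t)) {H k n : ℕ}
    (hH : ∀ x, (Finset.univ.filter fun v => x ∈ T.subtree v).card ≤ H) (hH₁ : 1 ≤ H)
    (hk : (nodes (C e)).card ≤ k) (hk' : (nodes (D (s + 1))).card ≤ k)
    (hn : α * n ≤ (posCost ρ C s e).card + (negCost ρ C s e).card + α * k) :
    phaseCost α ρ C s e + α * n ≤ H * (30 * phaseCost α ρ D s e + 20 * (α * k)) := by
  have h₁ := h.card_outPeriods_le hD hH
  have h₂ := h.card_posCost_le hD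
  have h₃ := h.card_negCost_le
  have h₄ := Nat.mul_le_mul_left α h.sum_evicted_le
  have h₅ := card_posCost_add_visited_le (α := α) (ρ := ρ) (s := s) (e := e) D
  have h₆ := Nat.mul_le_mul_left α hk
  have h₇ := Nat.mul_le_mul_left α hk'
  have h₈ : phaseCost α ρ D s e ≤ H * phaseCost α ρ D s e := Nat.le_mul_of_pos_left _ hH₁
  have h₉ : α * k ≤ H * (α * k) := Nat.le_mul_of_pos_left _ hH₁
  have h₁₀ := Nat.mul_le_mul_left H h₆
  have h₁₁ : phaseCost α ρ C s e = (posCost ρ C s e).card + (negCost ρ C s e).card +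
      (α * (outPeriods C s e).card + α * ∑ t ∈ Finset.Ioo s e, (evicted C t).card) := by
    rw [phaseCost, Finset.sum_add_distrib, sum_fetched_eq, mul_add]
  rw [sum_fetched_eq] at h₂
  rw [h₁₁]
  linarith

/-- In a finished phase, the cost of any schedule with smaller caches is large. -/
lemma le_phaseCost (h : IsPhase T α ρ s e C) (hD : ∀ t, T.Subforest (D t)) {X : Finset V}
    (hXC : ∀ v ∈ X, v ∉ C e) (hX : ∀ v ∈ X, ∀ x ∈ T.subtree v, x ∉ C e → x ∈ X)
    (hsat : α * X.card ≤ ∑ v ∈ X, (posReqs ρ C s e v).card) :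
    α * ((nodes (C e)).card + X.card) ≤
      phaseCost α ρ D s e + α * (nodes (D (s + 1))).card := by
  set Z := visited D s e with hZ
  have hZsub : ∀ v ∈ Z, ∀ x ∈ T.subtree v, x ∈ Z := fun v hv x hx => by
    obtain ⟨r, hr, hvr⟩ := mem_visited.1 hv
    exact mem_visited.2 ⟨r, hr, hD r v hvr hx⟩
  let W : ℕ → Finset V := fun t => if t = e then X else fetched C t
  let W' : ℕ → Finset V := fun t => (W t).filter fun v => v ∉ Z
  have hWC : ∀ t, ∀ v ∈ W t, v ∉ C t := fun t v hv => by
    by_cases hte : t = e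
    · subst hte
      exact hXC v (by simpa [W] using hv)
    · exact (mem_fetched.1 (by simpa only [W, if_neg hte] using hv)).1
  have hWcl : ∀ t, ∀ v ∈ W t, ∀ x ∈ T.subtree v, x ∉ C t → x ∈ W t := fun t v hv x hx hxC => by
    by_cases hte : t = e
    · subst hte
      simp only [W, if_true] at hv ⊢
      exact hX v hv x hx hxC
    · simp only [W, if_neg hte] at hv ⊢
      exact mem_fetched.2 ⟨hxC, h.sub _ v (mem_fetched.1 hv).2 hx⟩
  have hWsat : ∀ t, s < t → t ≤ e → α * (W t).card ≤ ∑ v ∈ W t, (posReqs ρ C s t v).card := by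
    intro t hst hte
    by_cases hte' : t = e
    · subst hte'
      simpa only [W, if_true] using hsat
    · simp only [W, if_neg hte']
      exact h.pos_sat t hst (by omega)
  have hWsat' : ∀ t, s < t → t ≤ e →
      α * (W' t).card ≤ ∑ v ∈ W' t, (posReqs ρ C s t v).card := by
    intro t hst hte
    have h₁ := Finset.sum_filter_add_sum_filter_not (W t) (fun v => v ∉ Z)
      fun v => (posReqs ρ C s t v).card
    have h₂ := Finset.card_filter_add_card_filter_not (s := W t) (fun v => v ∉ Z)
    have h₃ := h.pos_le t hst hte ((W t).filter fun v => ¬ v ∉ Z)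
      (fun v hv => hWC t v (Finset.mem_filter.1 hv).1) fun v hv x hx hxC => by
        obtain ⟨hv, hvZ⟩ := Finset.mem_filter.1 hv
        exact Finset.mem_filter.2 ⟨hWcl t v hv x hx hxC,
          not_not.2 (hZsub v (not_not.1 hvZ) x hx)⟩
    have h₄ := hWsat t hst hte
    rw [← h₂, mul_add] at h₄
    simp only [W']
    omega
  have hle : α * ((Finset.Ioc s e).sigma W').card ≤ (posCost ρ D s e).card := by
    calc α * ((Finset.Ioc s e).sigma W').card
        ≤ ∑ i ∈ (Finset.Ioc s e).sigma W', (posReqs ρ C s i.1 i.2).card := by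
          rw [Finset.card_sigma, Finset.mul_sum, Finset.sum_sigma]
          exact Finset.sum_le_sum fun t ht =>
            hWsat' t (Finset.mem_Ioc.1 ht).1 (Finset.mem_Ioc.1 ht).2
      _ ≤ _ := by
        refine sum_card_le_of_disjoint ?_ ?_
        · rintro ⟨t, v⟩ hi r hr
          obtain ⟨ht, hv⟩ := Finset.mem_sigma.1 hi
          obtain ⟨⟨h₁, h₂⟩, h₃, h₄⟩ := mem_posReqs.1 hr
          have ht := Finset.mem_Ioc.1 ht
          dsimp only at *
          refine Finset.mem_filter.2 ⟨Finset.mem_Ioc.2 ⟨h₁, by omega⟩, by rw [h₃], fun hvD => ?_⟩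
          rw [h₃] at hvD
          exact (Finset.mem_filter.1 hv).2 (mem_visited.2 ⟨r, ⟨h₁, by omega⟩, hvD⟩)
        · rintro ⟨t, v⟩ hi ⟨t', v'⟩ hi' r hr hr'
          obtain ⟨ht, hv⟩ := Finset.mem_sigma.1 hi
          obtain ⟨ht', hv'⟩ := Finset.mem_sigma.1 hi'
          obtain ⟨⟨h₁, h₂⟩, h₃, h₄⟩ := mem_posReqs.1 hr
          obtain ⟨⟨h₅, h₆⟩, h₇, h₈⟩ := mem_posReqs.1 hr'
          rw [Finset.mem_Ioc] at ht ht'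
          dsimp only at *
          obtain rfl : v = v' := by simpa using h₃.symm.trans h₇
          have key : ∀ t t', t < t' → t' ≤ e → v ∈ W t → StaysOut C v r t' → r ≤ t →
              False := by
            intro t t' hlt hte hv hout hr
            simp only [W, if_neg (by omega : ¬ t = e)] at hv
            exact hout (t + 1) (by omega) hlt (mem_fetched.1 hv).2
          rcases lt_trichotomy t t' with hlt | rfl | hlt
          · exact (key t t' hlt ht'.2 (Finset.mem_filter.1 hv).1 h₈ h₂).elim
          · rfl
          · exact (key t' t hlt ht.2 (Finset.mem_filter.1 hv').1 h₄ h₆).elim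
  have hcover : nodes (C e) ∪ X ⊆ ((Finset.Ioc s e).sigma W').image Sigma.snd ∪ Z := by
    intro v hv
    by_cases hvZ : v ∈ Z
    · exact Finset.mem_union_right _ hvZ
    refine Finset.mem_union_left _ (Finset.mem_image.2 ?_)
    rcases Finset.mem_union.1 hv with hv | hv
    · obtain ⟨τ, h₁, h₂, h₃, h₄⟩ := exists_first (p := fun t => v ∈ C t) (r := s + 1) h.lt
        (by simp [h.init]) (mem_nodes.1 hv)
      refine ⟨⟨τ, v⟩, Finset.mem_sigma.2 ⟨Finset.mem_Ioc.2 ⟨h₁, h₂.le⟩,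
        Finset.mem_filter.2 ⟨?_, hvZ⟩⟩, rfl⟩
      simp only [W, if_neg h₂.ne]
      exact mem_fetched.2 ⟨h₃ τ h₁ le_rfl, h₄⟩
    · exact ⟨⟨e, v⟩, Finset.mem_sigma.2 ⟨Finset.mem_Ioc.2 ⟨h.lt, le_rfl⟩,
        Finset.mem_filter.2 ⟨by simpa [W] using hv, hvZ⟩⟩, rfl⟩
  have h₁ := (Finset.card_le_card hcover).trans (Finset.card_union_le _ _)
  have h₂ := Nat.mul_le_mul_left α (h₁.trans (Nat.add_le_add_right Finset.card_image_le _))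
  have h₃ := card_posCost_add_visited_le (α := α) (ρ := ρ) (s := s) (e := e) D
  rw [mul_add] at h₂
  rw [← hZ] at h₃
  rw [← Finset.card_union_of_disjoint
    (Finset.disjoint_left.2 fun v hv hvX => hXC v hvX (mem_nodes.1 hv))]
  omega

end IsPhase

section Counters

variable {V : Type} [Fintype V]

lemma ncard_eq_card_nodes (A : Set V) : A.ncard = (IsPhase.nodes A).card := by
  rw [← Set.ncard_coe_finset]
  congr 1
  ext v
  simp

lemma nodes_coe (Y : Finset V) : IsPhase.nodes (Y : Set V) = Y := by
  ext v
  simp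

lemma cntSum_eq (f : V → ℕ) (A : Set V) : cntSum f A = ∑ v ∈ IsPhase.nodes A, f v := by
  rw [cntSum, IsPhase.nodes, Finset.sum_filter]
  simp only [Set.indicator_apply]

lemma cntSum_union {f : V → ℕ} {A B : Set V} (h : Disjoint A B) :
    cntSum f (A ∪ B) = cntSum f A + cntSum f B := by
  rw [cntSum, cntSum, cntSum, ← Finset.sum_add_distrib, Set.indicator_union_of_disjoint h]

lemma cntSum_mono {f g : V → ℕ} {A B : Set V} (h : ∀ v ∈ A, f v ≠ 0 → v ∈ B ∧ f v ≤ g v) :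
    cntSum f A ≤ cntSum g B := by
  refine Finset.sum_le_sum fun v _ => ?_
  by_cases hv : v ∈ A
  · by_cases hf : f v = 0
    · rw [Set.indicator_of_mem hv, hf]
      exact Nat.zero_le _
    · rw [Set.indicator_of_mem hv, Set.indicator_of_mem (h v hv hf).1]
      exact (h v hv hf).2
  · simp [hv]

lemma cntSum_add_ite [DecidableEq V] (f : V → ℕ) (p : Prop) (x : V) (A : Set V) :
    cntSum (fun v => f v + if x = v ∧ p then 1 else 0) A ≤
      cntSum f A + if x ∈ A then 1 else 0 := by
  rw [cntSum_eq, cntSum_eq, Finset.sum_add_distrib]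
  refine Nat.add_le_add_left ?_ _
  calc ∑ v ∈ IsPhase.nodes A, (if x = v ∧ p then 1 else 0)
      ≤ ∑ v ∈ IsPhase.nodes A, (if x = v then 1 else 0) :=
        Finset.sum_le_sum fun v _ => by
          by_cases hx : x = v <;> by_cases hp : p <;> simp [hx, hp]
    _ = _ := by rw [Finset.sum_ite_eq]; simp

lemma ncard_mul_pos {α : ℕ} (hα : 1 ≤ α) {Y : Set V} (hY : Y.Nonempty) : 0 < Y.ncard * α :=
  Nat.mul_pos ((Set.ncard_pos (Set.toFinite _)).2 hY) hα

end Counters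

section Requests

variable {V : Type}

lemma card_posReqs_succ [DecidableEq V] {ρ : ℕ → Request V} {C : ℕ → Set V} {s t : ℕ} {v : V} (hst : s ≤ t)
    (hv : v ∉ C (t + 1)) :
    (posReqs ρ C s (t + 1) v).card =
      (if v ∈ C t then 0 else (posReqs ρ C s t v).card) +
        if ρ (t + 1) = (v, true) then 1 else 0 := by
  have h : posReqs ρ C s (t + 1) v = (if v ∈ C t then ∅ else posReqs ρ C s t v) ∪
      if ρ (t + 1) = (v, true) then {t + 1} else ∅ := by
    ext r
    have key : StaysOut C v r (t + 1) ↔ r = t + 1 ∨ t + 1 < r ∨ v ∉ C t ∧ StaysOut C v r t := by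
      constructor
      · intro h
        rcases lt_or_ge r (t + 1) with hr | hr
        · exact Or.inr (Or.inr ⟨h t (by omega) (by omega), h.mono le_rfl (by omega)⟩)
        · omega
      · intro h τ h₁ h₂
        rcases Nat.lt_succ_iff_lt_or_eq.1 (Nat.lt_succ_of_le h₂) with h₃ | rfl
        · rcases h with h | h | h
          · omega
          · omega
          · exact h.2 τ h₁ (by omega)
        · exact hv
    rw [Finset.mem_union, mem_posReqs, key]
    split_ifs with h₁ h₂ h₂ <;> simp only [h₁, Finset.notMem_empty, mem_posReqs,
      Finset.mem_singleton, not_true, not_false_iff, true_and, false_and, false_or, or_false]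
    · constructor
      · rintro ⟨h₃, h₄, h₅⟩
        omega
      · rintro rfl
        exact ⟨⟨by omega, le_rfl⟩, h₂, Or.inl rfl⟩
    · constructor
      · rintro ⟨h₃, h₄, rfl | h₅⟩
        · exact h₂ h₄
        · omega
      · exact False.elim
    · constructor
      · rintro ⟨h₃, h₄, h₅ | h₅ | h₅⟩
        · exact Or.inr h₅
        · omega
        · by_cases hr : r = t + 1
          · exact Or.inr hr
          · exact Or.inl ⟨⟨h₃.1, by omega⟩, h₄, h₅⟩
      · rintro (⟨h₃, h₄, h₅⟩ | rfl)
        · exact ⟨⟨h₃.1, by omega⟩, h₄, Or.inr (Or.inr h₅)⟩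
        · exact ⟨⟨by omega, le_rfl⟩, h₂, Or.inl rfl⟩
    · constructor
      · rintro ⟨h₃, h₄, rfl | h₅ | h₅⟩
        · exact absurd h₄ h₂
        · omega
        · by_cases hr : r = t + 1
          · exact absurd (hr ▸ h₄) h₂
          · exact ⟨⟨h₃.1, by omega⟩, h₄, h₅⟩
      · rintro ⟨h₃, h₄, h₅⟩
        exact ⟨⟨h₃.1, by omega⟩, h₄, Or.inr (Or.inr h₅)⟩
  rw [h, Finset.card_union_of_disjoint]
  · split_ifs <;> simp
  · refine Finset.disjoint_left.2 fun r h₁ h₂ => ?_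
    split_ifs at h₁ h₂ <;> simp at h₁ h₂
    omega

lemma posReqs_compl (ρ : ℕ → Request V) (C : ℕ → Set V) (s t : ℕ) (v : V) :
    negReqs ρ C s t v =
      posReqs (fun r => ((ρ r).1, !(ρ r).2)) (fun t => (C t)ᶜ) s t v := by
  ext r
  rw [mem_negReqs, mem_posReqs]
  simp [StaysOut, StaysIn, Prod.ext_iff]

lemma card_negReqs_succ [DecidableEq V] {ρ : ℕ → Request V} {C : ℕ → Set V} {s t : ℕ} {v : V} (hst : s ≤ t)
    (hv : v ∈ C (t + 1)) :
    (negReqs ρ C s (t + 1) v).card =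
      (if v ∈ C t then (negReqs ρ C s t v).card else 0) +
        if ρ (t + 1) = (v, false) then 1 else 0 := by
  rw [posReqs_compl, posReqs_compl, card_posReqs_succ hst (by simpa using hv)]
  simp [Prod.ext_iff]

end Requests

section Costs

open IsPhase

variable {V : Type}

lemma card_costly_eq (ρ : ℕ → Request V) (D : ℕ → Set V) (s e : ℕ) :
    ((Finset.Ioc s e).filter fun r => Costly (ρ r) (D r)).card =
      (posCost ρ D s e).card + (negCost ρ D s e).card := by
  rw [posCost, negCost, ← Finset.card_union_of_disjoint, ← Finset.filter_or]
  · congr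
  · refine Finset.disjoint_filter.2 fun r _ h₁ h₂ => ?_
    simp [h₁.1] at h₂

lemma Icc_one_eq {s e : ℕ} (hse : s < e) :
    Finset.Icc 1 e = Finset.Icc 1 s ∪ Finset.Ioc s e ∧
      Disjoint (Finset.Icc 1 s) (Finset.Ioc s e) := by
  refine ⟨?_, Finset.disjoint_left.2 fun r h₁ h₂ => ?_⟩
  · ext r
    simp only [Finset.mem_union, Finset.mem_Icc, Finset.mem_Ioc]
    omega
  · rw [Finset.mem_Icc] at h₁
    rw [Finset.mem_Ioc] at h₂
    omega

lemma card_costly_add (ρ : ℕ → Request V) (D : ℕ → Set V) {s e : ℕ} (hse : s < e) :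
    ((Finset.Icc 1 e).filter fun r => Costly (ρ r) (D r)).card =
      ((Finset.Icc 1 s).filter fun r => Costly (ρ r) (D r)).card +
        ((posCost ρ D s e).card + (negCost ρ D s e).card) := by
  rw [← card_costly_eq, (Icc_one_eq hse).1, Finset.filter_union,
    Finset.card_union_of_disjoint (Finset.disjoint_filter_filter (Icc_one_eq hse).2)]

lemma sum_posReqs_le (ρ : ℕ → Request V) (C : ℕ → Set V) {s e : ℕ} (X : Finset V) :
    ∑ v ∈ X, (posReqs ρ C s e v).card ≤ (posCost ρ C s e).card := by
  refine sum_card_le_of_disjoint (fun v _ r hr => ?_) fun v _ w _ r h₁ h₂ => ?_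
  · obtain ⟨h₁, h₂, h₃⟩ := mem_posReqs.1 hr
    exact Finset.mem_filter.2 ⟨Finset.mem_Ioc.2 h₁, by rw [h₂], by
      rw [h₂]
      exact h₃ r le_rfl h₁.2⟩
  · simpa using (mem_posReqs.1 h₁).2.1.symm.trans (mem_posReqs.1 h₂).2.1

lemma sum_negReqs_le (ρ : ℕ → Request V) (C : ℕ → Set V) {s e : ℕ} (X : Finset V) :
    ∑ v ∈ X, (negReqs ρ C s e v).card ≤ (negCost ρ C s e).card := by
  refine sum_card_le_of_disjoint (fun v _ r hr => ?_) fun v _ w _ r h₁ h₂ => ?_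
  · obtain ⟨h₁, h₂, h₃⟩ := mem_negReqs.1 hr
    exact Finset.mem_filter.2 ⟨Finset.mem_Ioc.2 h₁, by rw [h₂], by
      rw [h₂]
      exact h₃ r le_rfl h₁.2⟩
  · simpa using (mem_negReqs.1 h₁).2.1.symm.trans (mem_negReqs.1 h₂).2.1

lemma card_fetched_add_evicted [Fintype V] (D : ℕ → Set V) (t : ℕ) :
    (D (t + 1) \ D t).ncard + (D t \ D (t + 1)).ncard =
      (fetched D t).card + (evicted D t).card := by
  rw [ncard_eq_card_nodes, ncard_eq_card_nodes]
  congr 2 <;> ext v <;> simp [and_comm]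

/-- The cost of a schedule is at least its cost up to round `s` plus its cost in the phase. -/
lemma scheduleCost_add_le [Fintype V] {α : ℕ} (ρ : ℕ → Request V) (D : ℕ → Set V) {s e : ℕ} (hse : s < e) :
    serveCost ρ D 1 s + moveCost α D 0 s + phaseCost α ρ D s e ≤
      serveCost ρ D 1 e + moveCost α D 0 e := by
  have h₁ : serveCost ρ D 1 e = serveCost ρ D 1 s + _ := card_costly_add ρ D hse
  have h₂ : moveCost α D 0 s +
      α * ∑ t ∈ Finset.Ioo s e, ((fetched D t).card + (evicted D t).card) ≤
        moveCost α D 0 e := by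
    simp only [moveCost, card_fetched_add_evicted]
    rw [← mul_add, ← Finset.sum_union]
    · refine Nat.mul_le_mul_left _ (Finset.sum_le_sum_of_subset fun t ht => ?_)
      simp only [Finset.mem_union, Finset.mem_Ico, Finset.mem_Ioo] at ht ⊢
      omega
    · refine Finset.disjoint_left.2 fun t h₁ h₂ => ?_
      rw [Finset.mem_Ico] at h₁
      rw [Finset.mem_Ioo] at h₂
      omega
  unfold phaseCost
  omega

end Costs

namespace RTree

variable {V : Type} {T : RTree V} {C : Set V}

lemma nonempty_of_valid {X : Set V} (h : T.Valid C X) : X.Nonempty :=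
  h.elim (fun h => h.1) fun h => h.1

lemma validPos_iff (hC : T.Subforest C) {X : Set V} :
    T.ValidPos C X ↔ X.Nonempty ∧ (∀ v ∈ X, v ∉ C) ∧
      ∀ v ∈ X, ∀ x ∈ T.subtree v, x ∉ C → x ∈ X := by
  refine and_congr_right fun _ => and_congr ?_ ⟨fun h v hv x hx hxC => ?_, fun h v hv x hx => ?_⟩
  · rw [← Set.disjoint_iff_inter_eq_empty, Set.disjoint_left]
  · exact (h v (Or.inr hv) hx).resolve_left hxC
  · rcases hv with hv | hv
    · exact Or.inl (hC v hv hx)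
    · by_cases hxC : x ∈ C
      · exact Or.inl hxC
      · exact Or.inr (h v hv x hx hxC)

lemma validNeg_iff (hC : T.Subforest C) {X : Set V} :
    T.ValidNeg C X ↔ X.Nonempty ∧ (∀ v ∈ X, v ∈ C) ∧
      ∀ v ∈ X, ∀ x ∈ C, v ∈ T.subtree x → x ∈ X := by
  refine and_congr_right fun _ => and_congr Iff.rfl
    ⟨fun h v hv x hx hvx => ?_, fun h v hv x hx => ?_⟩
  · by_contra hxX
    exact (h x ⟨hx, hxX⟩ hvx).2 hv
  · exact ⟨hC v hv.1 hx, fun hxX => hv.2 (h x hxX v hv.1 hx)⟩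

end RTree

namespace TCRun

open IsPhase

variable {V : Type} [Fintype V] [DecidableEq V] {T : RTree V} {α kONL : ℕ}
  {req : ℕ → Request V}

/-- The counters right after the cache change at time `t`. -/
noncomputable def cntPost (E : TCRun T α kONL req) (t : ℕ) (v : V) : ℕ :=
  if E.newPhase t ∨ ∃ X, E.chg t = some X ∧ v ∈ X then 0 else E.cnt t v

lemma cntSum_succ_le (E : TCRun T α kONL req) (t : ℕ) (Y : Set V) :
    cntSum (E.cnt (t + 1)) Y ≤
      cntSum (E.cntPost t) Y + if (req (t + 1)).1 ∈ Y then 1 else 0 := by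
  rw [show E.cnt (t + 1) = fun v => E.cntPost t v +
    if (req (t + 1)).1 = v ∧ Costly (req (t + 1)) (E.cache (t + 1)) then 1 else 0 from
    funext (E.cnt_rec t)]
  exact cntSum_add_ite (E.cntPost t) _ _ Y

lemma cntPost_lt (E : TCRun T α kONL req) (hα : 1 ≤ α) {t : ℕ}
    (ih : ∀ Y, T.Valid (E.cache t) Y → cntSum (E.cnt t) Y ≤ Y.ncard * α ∧
      ((req t).1 ∉ Y → cntSum (E.cnt t) Y < Y.ncard * α)) {Y : Set V}
    (hY : T.Valid (E.cache (t + 1)) Y) : cntSum (E.cntPost t) Y < Y.ncard * α := by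
  have hpos := ncard_mul_pos hα (RTree.nonempty_of_valid hY)
  by_cases hn : E.newPhase t
  · have : cntSum (E.cntPost t) Y = 0 := by simp [cntSum, cntPost, hn]
    omega
  have hC := E.cache_subforest t
  have hC' := E.cache_subforest (t + 1)
  rcases hX : E.chg t with _ | X
  · have h := E.step_none t hX
    have : E.cntPost t = E.cnt t := by
      funext v
      simp [cntPost, hn, hX]
    rw [this]
    exact h.2.2 Y (h.1 ▸ hY)
  obtain ⟨hv, hsat, hmax, hstep⟩ := E.step_some t X hX
  have hreq : (req t).1 ∈ X := by
    by_contra hc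
    exact absurd hsat (not_le.2 ((ih X hv).2 hc))
  have hpost : ∀ Z : Set V, Y \ X ⊆ Z → cntSum (E.cntPost t) Y ≤ cntSum (E.cnt t) Z := by
    refine fun Z hZ => cntSum_mono fun v hvY hv0 => ?_
    have hvX : v ∉ X := fun hvX => hv0 (if_pos (Or.inr ⟨X, hX, hvX⟩))
    refine ⟨hZ ⟨hvY, hvX⟩, ?_⟩
    unfold cntPost
    split_ifs
    · exact Nat.zero_le _
    · exact le_rfl
  have hsame : T.Valid (E.cache t) (X ∪ Y) → Disjoint X Y →
      cntSum (E.cntPost t) Y < Y.ncard * α := by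
    intro hval hdisj
    obtain ⟨y, hy⟩ := RTree.nonempty_of_valid hY
    have h := hmax (X ∪ Y) hval (Set.ssubset_iff_of_subset Set.subset_union_left |>.2
      ⟨y, Or.inr hy, fun hyX => Set.disjoint_left.1 hdisj hyX hy⟩)
    rw [cntSum_union hdisj, Set.ncard_union_eq hdisj, add_mul] at h
    have := hpost Y Set.sdiff_subset
    omega
  have hopp : (∀ Z, Z = Y \ X → Z.Nonempty → T.Valid (E.cache t) Z) →
      cntSum (E.cntPost t) Y < Y.ncard * α := by
    intro hval
    have h₁ := hpost (Y \ X) le_rfl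
    rcases (Y \ X).eq_empty_or_nonempty with h₀ | h₀
    · rw [h₀] at h₁
      have : cntSum (E.cnt t) ∅ = 0 := by simp [cntSum]
      omega
    · have h₂ := (ih _ (hval _ rfl h₀)).2 fun h => h.2 hreq
      have h₃ := Nat.mul_le_mul_right α (Set.ncard_le_ncard (Set.sdiff_subset : Y \ X ⊆ Y))
      omega
  rcases hstep with ⟨hXv, -, hcache, -⟩ | ⟨-, -, -, hn'⟩ | ⟨hXv, hcache, -⟩
  · obtain ⟨-, h₁, h₂⟩ := (RTree.validPos_iff hC).1 hXv
    rcases hY with hY | hY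
    · obtain ⟨hne, h₃, h₄⟩ := (RTree.validPos_iff hC').1 hY
      rw [hcache] at h₃ h₄
      refine hsame (Or.inl ((RTree.validPos_iff hC).2 ⟨hne.inr, ?_, ?_⟩))
        (Set.disjoint_left.2 fun v hv hvY => h₃ v hvY (Or.inr hv))
      · rintro v (hv | hv)
        · exact h₁ v hv
        · exact fun hvC => h₃ v hv (Or.inl hvC)
      · rintro v (hv | hv) x hx hxC
        · exact Or.inl (h₂ v hv x hx hxC)
        · by_cases hxX : x ∈ X
          · exact Or.inl hxX
          · exact Or.inr (h₄ v hv x hx fun h => h.elim hxC hxX)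
    · obtain ⟨-, h₃, h₄⟩ := (RTree.validNeg_iff hC').1 hY
      rw [hcache] at h₃ h₄
      refine hopp fun Z hZ hne => Or.inr ((RTree.validNeg_iff hC).2 ⟨hne, ?_, ?_⟩) <;> subst hZ
      · exact fun v hv => (h₃ v hv.1).resolve_right hv.2
      · exact fun v hv x hx hvx => ⟨h₄ v hv.1 x (Or.inl hx) hvx, fun hxX => h₁ x hxX hx⟩
  · exact absurd hn' hn
  · obtain ⟨-, h₁, h₂⟩ := (RTree.validNeg_iff hC).1 hXv
    rcases hY with hY | hY
    · obtain ⟨-, h₃, h₄⟩ := (RTree.validPos_iff hC').1 hY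
      rw [hcache] at h₃ h₄
      refine hopp fun Z hZ hne => Or.inl ((RTree.validPos_iff hC).2 ⟨hne, ?_, ?_⟩) <;> subst hZ
      · exact fun v hv hvC => h₃ v hv.1 ⟨hvC, hv.2⟩
      · exact fun v hv x hx hxC => ⟨h₄ v hv.1 x hx fun h => hxC h.1, fun hxX => hxC (h₁ x hxX)⟩
    · obtain ⟨hne, h₃, h₄⟩ := (RTree.validNeg_iff hC').1 hY
      rw [hcache] at h₃ h₄
      refine hsame (Or.inr ((RTree.validNeg_iff hC).2 ⟨hne.inr, ?_, ?_⟩))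
        (Set.disjoint_left.2 fun v hv hvY => (h₃ v hvY).2 hv)
      · rintro v (hv | hv)
        · exact h₁ v hv
        · exact (h₃ v hv).1
      · rintro v (hv | hv) x hx hvx
        · exact Or.inl (h₂ v hv x hx hvx)
        · by_cases hxX : x ∈ X
          · exact Or.inl hxX
          · exact Or.inr (h₄ v hv x ⟨hx, hxX⟩ hvx)

/-- No valid changeset is over-requested, and only valid changesets containing the node of the
current request can be saturated. -/
lemma cntSum_le (E : TCRun T α kONL req) (hα : 1 ≤ α) (t : ℕ) :
    ∀ Y, T.Valid (E.cache t) Y → cntSum (E.cnt t) Y ≤ Y.ncard * α ∧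
      ((req t).1 ∉ Y → cntSum (E.cnt t) Y < Y.ncard * α) := by
  induction t with
  | zero =>
    intro Y hY
    have h₀ : cntSum (E.cnt 0) Y = 0 := by simp [cntSum, E.cnt_zero]
    have := ncard_mul_pos hα (RTree.nonempty_of_valid hY)
    omega
  | succ t ih =>
    intro Y hY
    have h₁ := E.cntPost_lt hα ih hY
    have h₂ := E.cntSum_succ_le t Y
    split_ifs at h₂ with h₃
    · exact ⟨by omega, fun h => absurd h₃ h⟩
    · exact ⟨by omega, fun _ => by omega⟩

/-- Outside the restarts, the changeset consists of the fetched and the evicted nodes. -/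
lemma mem_chg_iff (E : TCRun T α kONL req) {t : ℕ} (hn : ¬ E.newPhase t) (v : V) :
    (∃ X, E.chg t = some X ∧ v ∈ X) ↔ v ∈ fetched E.cache t ∨ v ∈ evicted E.cache t := by
  rw [mem_fetched, mem_evicted]
  rcases hX : E.chg t with _ | X
  · rw [(E.step_none t hX).1]
    simp
  · simp only [Option.some.injEq, exists_eq_left']
    rcases (E.step_some t X hX).2.2.2 with ⟨hXv, -, hcache, -⟩ | ⟨-, -, -, hn'⟩ | ⟨hXv, hcache, -⟩
    · have := ((RTree.validPos_iff (E.cache_subforest t)).1 hXv).2.1 v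
      rw [hcache, Set.mem_union]
      tauto
    · exact absurd hn' hn
    · have := ((RTree.validNeg_iff (E.cache_subforest t)).1 hXv).2.1 v
      rw [hcache, Set.mem_sdiff]
      tauto

lemma chgSize_eq (E : TCRun T α kONL req) {t : ℕ} (hn : ¬ E.newPhase t) :
    chgSize (E.chg t) = (fetched E.cache t).card + (evicted E.cache t).card := by
  rw [← Finset.card_union_of_disjoint
    (Finset.disjoint_left.2 fun v h₁ h₂ => (mem_fetched.1 h₁).1 (mem_evicted.1 h₂).1)]
  have h := E.mem_chg_iff hn
  rcases hX : E.chg t with _ | X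
  · rw [chgSize, eq_comm, Finset.card_eq_zero]
    refine Finset.eq_empty_of_forall_notMem fun v hv => ?_
    obtain ⟨X, hX', -⟩ := (h v).2 (Finset.mem_union.1 hv)
    rw [hX] at hX'
    cases hX'
  · rw [chgSize, ncard_eq_card_nodes]
    congr 1
    ext v
    rw [Finset.mem_union, ← h v, hX, mem_nodes]
    simp

lemma chg_zero (E : TCRun T α kONL req) (hα : 1 ≤ α) : E.chg 0 = none := by
  rcases hX : E.chg 0 with _ | X
  · rfl
  · obtain ⟨h₁, h₂, -⟩ := E.step_some 0 X hX
    have h₃ : cntSum (E.cnt 0) X = 0 := by simp [cntSum, E.cnt_zero]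
    have := ncard_mul_pos hα (RTree.nonempty_of_valid h₁)
    omega

lemma cache_start (E : TCRun T α kONL req) (hα : 1 ≤ α) {s : ℕ} (hs : s = 0 ∨ E.newPhase s) :
    E.cache (s + 1) = ∅ := by
  rcases hs with rfl | hs
  · rw [(E.step_none 0 (E.chg_zero hα)).1, E.cache_zero]
  · rcases hX : E.chg s with _ | X
    · exact absurd hs (E.step_none s hX).2.1
    · rcases (E.step_some s X hX).2.2.2 with ⟨-, -, -, h⟩ | ⟨-, -, h, -⟩ | ⟨-, -, h⟩
      · exact absurd hs h
      · exact h
      · exact absurd hs h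

lemma cntPost_start (E : TCRun T α kONL req) {s : ℕ} (hs : s = 0 ∨ E.newPhase s) (v : V) :
    E.cntPost s v = 0 := by
  rcases hs with rfl | hs
  · simp [cntPost, E.cnt_zero]
  · exact if_pos (Or.inl hs)

/-- The counters count the requests in the current periods of the nodes. -/
lemma cnt_eq (E : TCRun T α kONL req) (hα : 1 ≤ α) {s e : ℕ} (hs : s = 0 ∨ E.newPhase s)
    (hn : ∀ t, s < t → t < e → ¬ E.newPhase t) {t : ℕ} (hst : s < t) (hte : t ≤ e) (v : V) :
    (v ∉ E.cache t → E.cnt t v = (posReqs req E.cache s t v).card) ∧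
      (v ∈ E.cache t → E.cnt t v = (negReqs req E.cache s t v).card) := by
  induction t, hst using Nat.le_induction with
  | base =>
    have h := E.cnt_rec s v
    rw [show (if E.newPhase s ∨ ∃ X, E.chg s = some X ∧ v ∈ X then 0 else E.cnt s v) = 0 from
      E.cntPost_start hs v, zero_add] at h
    have hv : v ∉ E.cache (s + 1) := by simp [E.cache_start hα hs]
    refine ⟨fun _ => ?_, fun h' => absurd h' hv⟩
    have h₀ : (posReqs req E.cache s s v).card = 0 := by simp [posReqs]
    rw [h, card_posReqs_succ le_rfl hv, h₀, ite_self, zero_add]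
    refine if_congr ⟨?_, ?_⟩ rfl rfl
    · rintro ⟨h₁, ⟨h₂, -⟩ | ⟨-, h₂⟩⟩
      · exact Prod.ext h₁ h₂
      · exact absurd (h₁ ▸ h₂) hv
    · intro h₁
      simp [h₁, Costly, hv]
  | succ t hst ih =>
    have ih := ih (by omega)
    have hnt := hn t hst hte
    have h := E.cnt_rec t v
    have hiff := E.mem_chg_iff hnt v
    rw [mem_fetched, mem_evicted] at hiff
    simp only [hnt, false_or, hiff] at h
    refine ⟨fun hv => ?_, fun hv => ?_⟩
    · rw [h, card_posReqs_succ (by omega) hv]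
      congr 1
      · by_cases hvt : v ∈ E.cache t
        · simp [hv, hvt]
        · simp [hv, hvt, ih.1 hvt]
      · refine if_congr ⟨?_, ?_⟩ rfl rfl
        · rintro ⟨h₁, ⟨h₂, -⟩ | ⟨-, h₂⟩⟩
          · exact Prod.ext h₁ h₂
          · exact absurd (h₁ ▸ h₂) hv
        · intro h₁
          simp [h₁, Costly, hv]
    · rw [h, card_negReqs_succ (by omega) hv]
      congr 1
      · by_cases hvt : v ∈ E.cache t
        · simp [hv, hvt, ih.2 hvt]
        · simp [hv, hvt]
      · refine if_congr ⟨?_, ?_⟩ rfl rfl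
        · rintro ⟨h₁, ⟨-, h₂⟩ | ⟨h₂, -⟩⟩
          · exact absurd (h₁ ▸ hv) h₂
          · exact Prod.ext h₁ h₂
        · intro h₁
          simp [h₁, Costly, hv]

lemma card_le_of_changed (E : TCRun T α kONL req) {t : ℕ} {A : Finset V} (f : V → ℕ)
    (hA : A.Nonempty → ∃ X, E.chg t = some X ∧ nodes X = A ∧ ∀ v ∈ A, E.cnt t v = f v) :
    α * A.card ≤ ∑ v ∈ A, f v := by
  rcases A.eq_empty_or_nonempty with rfl | hne
  · simp
  · obtain ⟨X, hX, rfl, hf⟩ := hA hne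
    have h := (E.step_some t X hX).2.1
    rwa [cntSum_eq, ncard_eq_card_nodes, mul_comm, Finset.sum_congr rfl hf] at h

lemma isPhase (E : TCRun T α kONL req) (hα : 1 ≤ α) {s e : ℕ} (hse : s < e)
    (hs : s = 0 ∨ E.newPhase s) (hn : ∀ t, s < t → t < e → ¬ E.newPhase t) :
    IsPhase T α req s e E.cache where
  lt := hse
  sub := E.cache_subforest
  init := E.cache_start hα hs
  pos_le t hst hte Y h₁ h₂ := by
    rcases Y.eq_empty_or_nonempty with rfl | hne
    · simp
    have hval : T.Valid (E.cache t) (Y : Set V) :=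
      Or.inl ((RTree.validPos_iff (E.cache_subforest t)).2 ⟨hne.to_set, h₁, h₂⟩)
    have h := (E.cntSum_le hα t _ hval).1
    rw [cntSum_eq, Set.ncard_coe_finset, nodes_coe, mul_comm] at h
    rwa [Finset.sum_congr rfl fun v hv => ((E.cnt_eq hα hs hn hst hte v).1 (h₁ v hv)).symm]
  neg_le t hst hte Y h₁ h₂ := by
    rcases Y.eq_empty_or_nonempty with rfl | hne
    · simp
    have hval : T.Valid (E.cache t) (Y : Set V) :=
      Or.inr ((RTree.validNeg_iff (E.cache_subforest t)).2 ⟨hne.to_set, h₁, h₂⟩)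
    have h := (E.cntSum_le hα t _ hval).1
    rw [cntSum_eq, Set.ncard_coe_finset, nodes_coe, mul_comm] at h
    rwa [Finset.sum_congr rfl fun v hv => ((E.cnt_eq hα hs hn hst hte v).2 (h₁ v hv)).symm]
  pos_sat t hst hte := by
    refine E.card_le_of_changed (t := t) _ fun ⟨w, hw⟩ => ?_
    obtain ⟨X, hX, hwX⟩ := (E.mem_chg_iff (hn t hst hte) w).2 (Or.inl hw)
    rw [mem_fetched] at hw
    refine ⟨X, hX, ?_, fun v hv =>
      (E.cnt_eq hα hs hn hst hte.le v).1 (mem_fetched.1 hv).1⟩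
    rcases (E.step_some t X hX).2.2.2 with ⟨hXv, -, hcache, -⟩ | ⟨-, -, -, hn'⟩ | ⟨hXv, -, -⟩
    · ext v
      have := ((RTree.validPos_iff (E.cache_subforest t)).1 hXv).2.1 v
      rw [mem_nodes, mem_fetched, hcache, Set.mem_union]
      tauto
    · exact absurd hn' (hn t hst hte)
    · exact absurd (((RTree.validNeg_iff (E.cache_subforest t)).1 hXv).2.1 w hwX) hw.1
  neg_sat t hst hte := by
    refine E.card_le_of_changed (t := t) _ fun ⟨w, hw⟩ => ?_
    obtain ⟨X, hX, hwX⟩ := (E.mem_chg_iff (hn t hst hte) w).2 (Or.inr hw)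
    rw [mem_evicted] at hw
    refine ⟨X, hX, ?_, fun v hv =>
      (E.cnt_eq hα hs hn hst hte.le v).2 (mem_evicted.1 hv).1⟩
    rcases (E.step_some t X hX).2.2.2 with ⟨hXv, -, -, -⟩ | ⟨-, -, -, hn'⟩ | ⟨hXv, hcache, -⟩
    · exact absurd hw.1 (((RTree.validPos_iff (E.cache_subforest t)).1 hXv).2.1 w hwX)
    · exact absurd hn' (hn t hst hte)
    · ext v
      have := ((RTree.validNeg_iff (E.cache_subforest t)).1 hXv).2.1 v
      rw [mem_nodes, mem_evicted, hcache, Set.mem_sdiff]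
      tauto

/-- The number of nodes fetched or evicted at time `t`. -/
noncomputable def changes (E : TCRun T α kONL req) (t : ℕ) : ℕ :=
  if E.newPhase t then (E.cache t).ncard else chgSize (E.chg t)

lemma cost_eq_add (E : TCRun T α kONL req) {s e : ℕ} (hse : s < e)
    (hn : ∀ t, s < t → t < e → ¬ E.newPhase t) :
    E.cost e = E.cost s + (phaseCost α req E.cache s e + α * E.changes e) := by
  have h₁ := card_costly_add req E.cache hse
  have h₂ : ∑ t ∈ Finset.Icc 1 e, E.changes t = ∑ t ∈ Finset.Icc 1 s, E.changes t +
      (∑ t ∈ Finset.Ioo s e, ((fetched E.cache t).card + (evicted E.cache t).card) +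
        E.changes e) := by
    have hIoc : Finset.Ioc s e = insert e (Finset.Ioo s e) := by
      ext t
      simp only [Finset.mem_Ioc, Finset.mem_insert, Finset.mem_Ioo]
      omega
    rw [(Icc_one_eq hse).1, Finset.sum_union (Icc_one_eq hse).2, hIoc,
      Finset.sum_insert (by simp), add_comm (E.changes e)]
    congr 2
    refine Finset.sum_congr rfl fun t ht => ?_
    have hnt := hn t (Finset.mem_Ioo.1 ht).1 (Finset.mem_Ioo.1 ht).2
    rw [changes, if_neg hnt, E.chgSize_eq hnt]
  have h₃ : ∀ N, E.cost N = ((Finset.Icc 1 N).filter fun r => Costly (req r) (E.cache r)).card +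
    α * ∑ t ∈ Finset.Icc 1 N, E.changes t := fun N => rfl
  rw [h₃, h₃, h₁, h₂, phaseCost]
  ring

lemma mul_changes_le (E : TCRun T α kONL req) (hα : 1 ≤ α) {s e : ℕ} (hse : s < e)
    (hs : s = 0 ∨ E.newPhase s) (hn : ∀ t, s < t → t < e → ¬ E.newPhase t) :
    α * E.changes e ≤ (posCost req E.cache s e).card + (negCost req E.cache s e).card +
      α * kONL := by
  by_cases hne : E.newPhase e
  · have := Nat.mul_le_mul_left α (E.capacity e)
    rw [changes, if_pos hne]
    omega
  rw [changes, if_neg hne]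
  rcases hX : E.chg e with _ | X
  · simp [chgSize]
  obtain ⟨hv, hsat, -⟩ := E.step_some e X hX
  rw [cntSum_eq, mul_comm] at hsat
  rw [chgSize]
  rcases hv with hv | hv
  · have h₁ := ((RTree.validPos_iff (E.cache_subforest e)).1 hv).2.1
    rw [Finset.sum_congr rfl fun v hv =>
      (E.cnt_eq hα hs hn hse le_rfl v).1 (h₁ v (mem_nodes.1 hv))] at hsat
    have := sum_posReqs_le req E.cache (s := s) (e := e) (nodes X)
    omega
  · have h₁ := ((RTree.validNeg_iff (E.cache_subforest e)).1 hv).2.1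
    rw [Finset.sum_congr rfl fun v hv =>
      (E.cnt_eq hα hs hn hse le_rfl v).2 (h₁ v (mem_nodes.1 hv))] at hsat
    have := sum_negReqs_le req E.cache (s := s) (e := e) (nodes X)
    omega

lemma phaseCost_of_newPhase (E : TCRun T α kONL req) (hα : 1 ≤ α) {s e kOPT : ℕ} (hse : s < e)
    (hs : s = 0 ∨ E.newPhase s) (hn : ∀ t, s < t → t < e → ¬ E.newPhase t)
    (hne : E.newPhase e) {D : ℕ → Set V} (hD : IsSchedule T kOPT D) :
    α * (kONL + 1) ≤ phaseCost α req D s e + α * kOPT := by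
  rcases hX : E.chg e with _ | X
  · exact absurd hne (E.step_none e hX).2.1
  obtain ⟨-, hsat, -, ⟨-, -, -, h⟩ | ⟨hv, hcard, -, -⟩ | ⟨-, -, h⟩⟩ := E.step_some e X hX
  · exact absurd hne h
  · obtain ⟨-, h₁, h₂⟩ := (RTree.validPos_iff (E.cache_subforest e)).1 hv
    rw [cntSum_eq, mul_comm, ncard_eq_card_nodes, Finset.sum_congr rfl fun v hv =>
      (E.cnt_eq hα hs hn hse le_rfl v).1 (h₁ v (mem_nodes.1 hv))] at hsat
    have h := (E.isPhase hα hse hs hn).le_phaseCost (fun t => (hD t).1) (X := nodes X)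
      (fun v hv => h₁ v (mem_nodes.1 hv))
      (fun v hv x hx hxC => mem_nodes.2 (h₂ v (mem_nodes.1 hv) x hx hxC)) hsat
    have h₃ := Set.ncard_union_le (E.cache e) X
    rw [ncard_eq_card_nodes (E.cache e), ncard_eq_card_nodes X] at h₃
    have h₄ := Nat.mul_le_mul_left α (Nat.succ_le_of_lt (hcard.trans_le h₃))
    have h₅ := Nat.mul_le_mul_left α (hD (s + 1)).2
    rw [ncard_eq_card_nodes] at h₅
    rw [Nat.succ_eq_add_one] at h₄
    omega
  · exact absurd hne h

lemma exists_phase_start (E : TCRun T α kONL req) {N : ℕ} (hN : 0 < N) :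
    ∃ s, s < N ∧ (s = 0 ∨ E.newPhase s) ∧ ∀ t, s < t → t < N → ¬ E.newPhase t := by
  refine ⟨Nat.findGreatest (fun t => t = 0 ∨ E.newPhase t) (N - 1), ?_, ?_, ?_⟩
  · exact (Nat.findGreatest_le _).trans_lt (by omega)
  · exact Nat.findGreatest_spec (P := fun t => t = 0 ∨ E.newPhase t) (Nat.zero_le _) (Or.inl rfl)
  · intro t h₁ h₂ h₃
    exact Nat.findGreatest_is_greatest (P := fun t => t = 0 ∨ E.newPhase t) h₁ (by omega)
      (Or.inr h₃)

/-- The competitive inequality against every schedule, with the denominators cleared; when a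
phase has just ended, there is no additive term. -/
lemma mul_cost_le (E : TCRun T α kONL req) (hα : 1 ≤ α) {kOPT d : ℕ} (hk : 1 ≤ kOPT)
    (hd : kONL = kOPT + d) {D : ℕ → Set V} (hD : IsSchedule T kOPT D) (N : ℕ) :
    (d + 1) * E.cost N ≤ 50 * T.height * kONL * (serveCost req D 1 N + moveCost α D 0 N) +
      if E.newPhase N then 0 else (d + 1) * (20 * T.height * (α * kONL)) := by
  induction N using Nat.strong_induction_on with
  | _ N ih =>
    rcases Nat.eq_zero_or_pos N with rfl | hN
    · simp [cost]
    obtain ⟨s, hsN, hs, hn⟩ := E.exists_phase_start hN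
    have hprev : (d + 1) * E.cost s ≤
        50 * T.height * kONL * (serveCost req D 1 s + moveCost α D 0 s) := by
      rcases hs with rfl | hs
      · simp [cost]
      · simpa [hs] using ih s hsN
    have hphase := (E.isPhase hα hsN hs hn).cost_le (fun t => (hD t).1) (k := kONL)
      (n := E.changes N) (H := T.height) (fun x => ?_) (Nat.le_add_left 1 _) ?_ ?_
      (E.mul_changes_le hα hsN hs hn)
    · rw [E.cost_eq_add hsN hn]
      have hD' := scheduleCost_add_le (α := α) req D hsN
      set P := phaseCost α req D s N
      have h₁ := Nat.mul_le_mul_left (50 * T.height * kONL) hD'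
      have h₂ := Nat.mul_le_mul_left (d + 1) hphase
      have h₃ : 30 * T.height * P * (d + 1) ≤ 30 * T.height * P * kONL :=
        Nat.mul_le_mul_left _ (by omega)
      split_ifs with hne
      · have h₄ := E.phaseCost_of_newPhase hα hsN hs hn hne hD
        have h₅ : α * (d + 1) ≤ P := by
          rw [hd, add_assoc, mul_add] at h₄
          omega
        have h₆ := Nat.mul_le_mul_left (20 * T.height * kONL) h₅
        linarith
      · have h₄ : 30 * T.height * P * kONL ≤ 50 * T.height * P * kONL :=
          Nat.mul_le_mul_right _ (Nat.mul_le_mul_right _ (Nat.mul_le_mul_right _ (by norm_num)))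
        linarith
    · convert T.card_ancestors_le_height x
    · rw [← ncard_eq_card_nodes]
      exact E.capacity N
    · rw [← ncard_eq_card_nodes]
      exact (hD (s + 1)).2.trans (by omega)

end TCRun

/-- `TC` is `O(h(T)·kONL/(kONL − kOPT + 1))`-competitive: there is a
universal constant `c > 0` such that on any finite rooted tree, for any even `α ≥ 1`,
any cache sizes `kONL ≥ kOPT ≥ 1` and any finite request sequence (rounds `1, …, N`),
`TC(I) ≤ c·h(T)·(kONL/(kONL − kOPT + 1))·OPT(I) + c·h(T)·kONL·α`. -/
theorem tc_competitive :
    ∃ c : ℝ, 0 < c ∧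
      ∀ (V : Type) [Fintype V] [DecidableEq V],
        ∀ (T : RTree V) (α kONL kOPT : ℕ) (req : ℕ → Request V)
          (E : TCRun T α kONL req) (N : ℕ),
          1 ≤ α → Even α → 1 ≤ kOPT → kOPT ≤ kONL →
          (E.cost N : ℝ) ≤
            c * (T.height : ℝ) * ((kONL : ℝ) / ((kONL : ℝ) - (kOPT : ℝ) + 1)) *
              (optCostEmpty T α kOPT req N : ℝ)
            + c * (T.height : ℝ) * (kONL : ℝ) * (α : ℝ) := by
  refine ⟨50, by norm_num, fun V _ _ T α kONL kOPT req E N hα _ hk hle => ?_⟩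
  obtain ⟨d, hd⟩ := Nat.exists_eq_add_of_le hle
  have hne : {n | ∃ D : ℕ → Set V, IsSchedule T kOPT D ∧ D 0 = ∅ ∧
      n = serveCost req D 1 N + moveCost α D 0 N}.Nonempty :=
    ⟨_, fun _ => ∅, fun _ => ⟨fun v hv => hv.elim, by simp⟩, rfl, rfl⟩
  obtain ⟨D, hD, -, hopt⟩ := Nat.sInf_mem hne
  have h := E.mul_cost_le hα hk hd hD N
  have hopt' : optCostEmpty T α kOPT req N = serveCost req D 1 N + moveCost α D 0 N := hopt
  rw [← hopt'] at h
  have h' : (d + 1) * E.cost N ≤ 50 * T.height * kONL * optCostEmpty T α kOPT req N +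
      (d + 1) * (50 * T.height * (α * kONL)) := by
    refine h.trans (Nat.add_le_add_left ?_ _)
    split_ifs
    · exact Nat.zero_le _
    · exact Nat.mul_le_mul_left _ (Nat.mul_le_mul_right _ (Nat.mul_le_mul_right _ (by norm_num)))
  have hR : (kONL : ℝ) - (kOPT : ℝ) + 1 = (d : ℝ) + 1 := by
    rw [hd]
    push_cast
    ring
  have hpos : (0 : ℝ) < (d : ℝ) + 1 := by positivity
  have h'' : ((d : ℝ) + 1) * (E.cost N : ℝ) ≤
      50 * (T.height : ℝ) * (kONL : ℝ) * (optCostEmpty T α kOPT req N : ℝ) +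
        ((d : ℝ) + 1) * (50 * (T.height : ℝ) * ((α : ℝ) * (kONL : ℝ))) := by
    exact_mod_cast h'
  rw [hR]
  refine le_of_mul_le_mul_left (h''.trans_eq ?_) hpos
  field_simp
end

section
/- There exists a constant c > 0 such that for every integer α ≥ 1, all cache sizes k_ONL ≥ k_OPT ≥ 1, every deterministic online algorithm A for online tree caching with cache size k_ONL, and every constant β, there exist a finite rooted tree T and a finite request sequence I over T with A(I) > c·(k_ONL/(k_ONL − k_OPT + 1))·OPT(I) + β, where OPT(I) is the minimum cost of serving I by an offline algorithm with cache size k_OPT. In other words, the competitive ratio of any deterministic online algorithm for online tree caching is at least Ω(k_ONL/(k_ONL − k_OPT + 1)). -/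
open scoped Classical

/-- An adaptive adversary against a causal process `B`: the request of round `t + 1` may be
chosen as a function of the state of `B` after round `t`. -/
theorem exists_adaptive_sequence {R S : Type*} [Nonempty R] (B : (ℕ → R) → ℕ → S)
    (hB : ∀ ρ ρ' t, (∀ s, 1 ≤ s → s ≤ t → ρ s = ρ' s) → B ρ t = B ρ' t) (f : S → R) :
    ∃ ρ : ℕ → R, ∀ t, ρ (t + 1) = f (B ρ t) := by
  let seq : ℕ → ℕ → R := fun t => Nat.rec (fun _ => Classical.arbitrary R)
    (fun t σ => Function.update σ (t + 1) (f (B σ t))) t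
  have hseq (t : ℕ) : seq (t + 1) = Function.update (seq t) (t + 1) (f (B (seq t) t)) := rfl
  have hstable (s d : ℕ) : seq (s + d) s = seq s s := by
    induction d with
    | zero => rfl
    | succ d ih =>
      rw [← Nat.add_assoc, hseq, Function.update_of_ne (by omega), ih]
  refine ⟨fun t => seq t t, fun t => ?_⟩
  have hcausal : B (fun t => seq t t) t = B (seq t) t := by
    refine hB _ _ _ fun s _ hs => ?_
    obtain ⟨d, rfl⟩ := Nat.exists_eq_add_of_le hs
    exact (hstable s d).symm
  simp only [hseq, Function.update_self, hcausal]

/-- Some `m` elements of `s` have a total weight at most their fair share. -/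
theorem Finset.exists_subset_card_mul_sum_le {ι : Type*} (s : Finset ι) (f : ι → ℕ) {m : ℕ}
    (hm : m ≤ s.card) :
    ∃ u ⊆ s, u.card = m ∧ s.card * ∑ i ∈ u, f i ≤ m * ∑ i ∈ s, f i := by
  induction hm using Nat.decreasingInduction with
  | self => exact ⟨s, subset_rfl, rfl, le_rfl⟩
  | of_succ m _ ih =>
    obtain ⟨u, hus, hcard, hle⟩ := ih
    obtain ⟨x, hx, hmax⟩ := u.exists_max_image f (Finset.card_pos.1 (by omega))
    refine ⟨u.erase x, (u.erase_subset x).trans hus, by simp [hx, hcard], ?_⟩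
    have hsum : ∑ i ∈ u.erase x, f i + f x = ∑ i ∈ u, f i := Finset.sum_erase_add _ _ hx
    have hle_max : ∑ i ∈ u.erase x, f i ≤ m * f x := by
      refine (Finset.sum_le_card_nsmul _ _ (f x) fun i hi =>
        hmax i (Finset.mem_of_mem_erase hi)).trans ?_
      simp [hx, hcard]
    rw [← hsum] at hle
    generalize ∑ i ∈ u.erase x, f i = a at *
    generalize f x = b at *
    generalize ∑ i ∈ s, f i = w at *
    have hscaled : (m + 1) * a ≤ m * (a + b) := by linarith
    have hpos : 0 < m + 1 := m.succ_pos
    refine Nat.le_of_mul_le_mul_left ?_ hpos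
    calc (m + 1) * (s.card * a) = s.card * ((m + 1) * a) := by ring
      _ ≤ s.card * (m * (a + b)) := Nat.mul_le_mul_left _ hscaled
      _ = m * (s.card * (a + b)) := by ring
      _ ≤ m * ((m + 1) * w) := Nat.mul_le_mul_left _ hle
      _ = (m + 1) * (m * w) := by ring

namespace RTree

/-- The star with center `0`. -/
def star (n : ℕ) : RTree (Fin (n + 1)) where
  root := 0
  parent _ := 0
  parent_root := rfl
  reaches_root _ := ⟨1, rfl⟩

theorem star_subforest {n : ℕ} {C : Set (Fin (n + 1))} (hC : 0 ∉ C) :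
    (star n).Subforest C := by
  rintro v hv w ⟨j, rfl⟩
  cases j with
  | zero => exact hv
  | succ j =>
    rw [Function.iterate_succ_apply'] at hv
    exact absurd hv hC

end RTree

/-- The offline cost is at most that of fetching `S` at the beginning and keeping it. -/
theorem optCostEmpty_le_static {V : Type} (T : RTree V) (α k : ℕ) (ρ : ℕ → Request V) (N : ℕ)
    {S : Set V} (hS : T.Subforest S) (hk : S.ncard ≤ k) :
    optCostEmpty T α k ρ N ≤ serveCost ρ (fun _ => S) 1 N + α * S.ncard := by
  let D : ℕ → Set V := fun t => if t = 0 then ∅ else S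
  have hD : IsSchedule T k D := by
    intro t
    by_cases ht : t = 0
    · simp [D, ht, RTree.Subforest]
    · simpa [D, ht] using ⟨hS, hk⟩
  have hserve : serveCost ρ D 1 N = serveCost ρ (fun _ => S) 1 N := by
    unfold serveCost
    congr 1
    refine Finset.filter_congr fun r hr => ?_
    have : r ≠ 0 := by have := (Finset.mem_Icc.1 hr).1; omega
    simp [D, this]
  have hmove : moveCost α D 0 N ≤ α * S.ncard := by
    refine Nat.mul_le_mul_left _ ?_
    calc ∑ t ∈ Finset.Ico 0 N, ((D (t + 1) \ D t).ncard + (D t \ D (t + 1)).ncard)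
        = ∑ t ∈ Finset.Ico 0 N, if t = 0 then S.ncard else 0 := by
          refine Finset.sum_congr rfl fun t _ => ?_
          by_cases ht : t = 0 <;> simp [D, ht]
      _ ≤ S.ncard := by
          rw [Finset.sum_ite_eq']
          split_ifs <;> simp
  calc optCostEmpty T α k ρ N ≤ serveCost ρ D 1 N + moveCost α D 0 N :=
        Nat.sInf_le ⟨D, hD, by simp [D], rfl⟩
    _ ≤ _ := by rw [hserve]; exact Nat.add_le_add_left hmove _

/-- On a star with `n` leaves, any sequence of positive requests to leaves is served offline at
roughly a fraction `(n - k) / n` of its length, by caching the most requested leaves. -/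
theorem star_optCostEmpty_le {n k : ℕ} (hk : k ≤ n) (α N : ℕ)
    (ρ : ℕ → Request (Fin (n + 1))) (hpos : ∀ r ∈ Finset.Icc 1 N, (ρ r).2 = true)
    (hleaf : ∀ r ∈ Finset.Icc 1 N, (ρ r).1 ≠ 0) :
    n * optCostEmpty (RTree.star n) α k ρ N ≤ (n - k) * N + n * (α * k) := by
  let L : Finset (Fin (n + 1)) := Finset.univ.erase 0
  have hL : L.card = n := by simp [L]
  let cnt : Fin (n + 1) → ℕ := fun v => ((Finset.Icc 1 N).filter fun r => (ρ r).1 = v).card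
  have htotal : ∑ v ∈ L, cnt v = N := by
    rw [← Finset.card_eq_sum_card_fiberwise (f := fun r => (ρ r).1) (s := Finset.Icc 1 N)]
    · simp
    · intro r hr
      simpa [L] using hleaf r hr
  obtain ⟨U, hUL, hUcard, hU⟩ :=
    L.exists_subset_card_mul_sum_le cnt (m := n - k) (by omega)
  rw [hL, htotal] at hU
  have hScard : ((L \ U : Finset _) : Set (Fin (n + 1))).ncard = k := by
    rw [Set.ncard_coe_finset, Finset.card_sdiff_of_subset hUL]
    omega
  have hopt := optCostEmpty_le_static (RTree.star n) α k ρ N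
    (S := ((L \ U : Finset _) : Set (Fin (n + 1))))
    (RTree.star_subforest (by simp [L])) hScard.le
  have hserve : serveCost ρ (fun _ => ((L \ U : Finset _) : Set (Fin (n + 1)))) 1 N
      ≤ ∑ v ∈ U, cnt v := by
    rw [Finset.sum_card_fiberwise_eq_card_filter (Finset.Icc 1 N) U fun r => (ρ r).1]
    refine Finset.card_le_card fun r hr => ?_
    obtain ⟨hrN, hcost⟩ := Finset.mem_filter.1 hr
    refine Finset.mem_filter.2 ⟨hrN, ?_⟩
    have hmiss : (ρ r).1 ∉ L \ U := by
      rcases hcost with ⟨_, hmiss⟩ | ⟨hneg, _⟩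
      · exact hmiss
      · simp [hpos r hrN] at hneg
    by_contra hrU
    exact hmiss (Finset.mem_sdiff.2 ⟨by simpa [L] using hleaf r hrN, hrU⟩)
  rw [hScard] at hopt
  calc n * optCostEmpty (RTree.star n) α k ρ N ≤ n * (∑ v ∈ U, cnt v + α * k) :=
        Nat.mul_le_mul_left _ (hopt.trans (Nat.add_le_add_right hserve _))
    _ ≤ _ := by rw [Nat.mul_add]; exact Nat.add_le_add_right hU _

/-- lower bound. There is a constant `c > 0` such that for every
`α ≥ 1`, all cache sizes `kONL ≥ kOPT ≥ 1`, every deterministic online algorithm `A`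
(choosing, for every finite rooted tree, a feasible cache after each round as a
function of the requests seen so far, starting from the empty cache) and every
constant `β`, there are a finite rooted tree and a finite request sequence on which
`A(I) > c·(kONL/(kONL − kOPT + 1))·OPT(I) + β`. -/
theorem tree_caching_deterministic_lower_bound :
    ∃ c : ℝ, 0 < c ∧
      ∀ (α kONL kOPT : ℕ), 1 ≤ α → 1 ≤ kOPT → kOPT ≤ kONL →
      ∀ A : (n : ℕ) → RTree (Fin n) → (ℕ → Request (Fin n)) → ℕ → Set (Fin n),
        (∀ (n : ℕ) (T : RTree (Fin n)) (ρ ρ' : ℕ → Request (Fin n)) (t : ℕ),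
          (∀ s, 1 ≤ s → s ≤ t → ρ s = ρ' s) → A n T ρ t = A n T ρ' t) →
        (∀ (n : ℕ) (T : RTree (Fin n)) (ρ : ℕ → Request (Fin n)), A n T ρ 0 = ∅) →
        (∀ (n : ℕ) (T : RTree (Fin n)) (ρ : ℕ → Request (Fin n)) (t : ℕ),
          T.Subforest (A n T ρ t) ∧ (A n T ρ t).ncard ≤ kONL) →
        ∀ β : ℝ, ∃ (n : ℕ) (T : RTree (Fin n)) (ρ : ℕ → Request (Fin n)) (N : ℕ),
          c * ((kONL : ℝ) / ((kONL : ℝ) - (kOPT : ℝ) + 1)) *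
              (optCostEmpty T α kOPT ρ N : ℝ) + β
            < ((serveCost ρ (fun r => A n T ρ (r - 1)) 1 N
                + moveCost α (A n T ρ) 0 N : ℕ) : ℝ) := by
  refine ⟨1 / 2, by norm_num, ?_⟩
  intro α k h _ _ hhk A hcausal _ hfeas β
  have hpick (C : Set (Fin (k + 1 + 1))) :
      ∃ v : Fin (k + 1 + 1), v ≠ 0 ∧ (C.ncard ≤ k → v ∉ C) := by
    by_cases hC : ∃ v : Fin (k + 1 + 1), v ≠ 0 ∧ v ∉ C
    · obtain ⟨v, hv, hvC⟩ := hC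
      exact ⟨v, hv, fun _ => hvC⟩
    · push Not at hC
      refine ⟨1, by simp, fun hcard => ?_⟩
      have hsub : ((Finset.univ.erase 0 : Finset (Fin (k + 1 + 1))) : Set _) ⊆ C := by
        intro v hv
        exact hC v (by simpa using hv)
      have := Set.ncard_le_ncard hsub (Set.toFinite C)
      rw [Set.ncard_coe_finset] at this
      simp at this
      omega
  choose pick hpick_ne hpick_notMem using hpick
  obtain ⟨ρ, hρ⟩ := exists_adaptive_sequence (A _ (RTree.star (k + 1)))
    (hcausal _ _) (fun C => (pick C, true))
  obtain ⟨N, hN⟩ := exists_nat_gt ((k : ℝ) * (α * h) + α * h + 2 * β)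
  refine ⟨_, RTree.star (k + 1), ρ, N, ?_⟩
  have hreq {r : ℕ} (hr : r ∈ Finset.Icc 1 N) :
      ρ r = (pick (A _ (RTree.star (k + 1)) ρ (r - 1)), true) := by
    have := hρ (r - 1)
    rwa [Nat.sub_add_cancel (Finset.mem_Icc.1 hr).1] at this
  have hopt := star_optCostEmpty_le (n := k + 1) (k := h) (by omega) α N ρ
    (fun r hr => by rw [hreq hr]) (fun r hr => by rw [hreq hr]; exact hpick_ne _)
  have hserve : serveCost ρ (fun r => A _ (RTree.star (k + 1)) ρ (r - 1)) 1 N = N := by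
    unfold serveCost
    rw [Finset.filter_true_of_mem, Nat.card_Icc, Nat.add_sub_cancel]
    intro r hr
    left
    rw [hreq hr]
    exact ⟨rfl, hpick_notMem _ (hfeas _ _ _ _).2⟩
  rw [hserve]
  generalize optCostEmpty (RTree.star (k + 1)) α h ρ N = opt at *
  have hcast : ((k : ℝ) + 1) * opt ≤ ((k : ℝ) - h + 1) * N + (k + 1) * (α * h) := by
    have := (Nat.cast_le (α := ℝ)).2 hopt
    push_cast [Nat.cast_sub (show h ≤ k + 1 by omega)] at this
    linarith
  have hd : (1 : ℝ) ≤ (k : ℝ) - h + 1 := by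
    have : (h : ℝ) ≤ k := by exact_mod_cast hhk
    linarith
  have hratio : (k : ℝ) / ((k : ℝ) - h + 1) * opt ≤ N + (k + 1) * (α * h) := by
    rw [div_mul_eq_mul_div, div_le_iff₀ (by linarith)]
    have hnonneg : (0 : ℝ) ≤ (k + 1) * (α * h) := by positivity
    have hopt_nonneg : (0 : ℝ) ≤ opt := by positivity
    nlinarith [mul_nonneg hnonneg (sub_nonneg.2 hd)]
  push_cast
  have hmove : (0 : ℝ) ≤ (moveCost α (A _ (RTree.star (k + 1)) ρ) 0 N : ℝ) := by positivity
  rw [mul_assoc]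
  linarith
end

section
/- Let T be a finite rooted tree, let C ⊆ T be a subforest of T, and let X be a valid positive changeset for C that is a tree cap rooted at a node u. Then X = T(u) \ C, i.e. X consists of exactly all non-cached nodes of the subtree T(u). -/
open scoped Classical

/-- if `X` is a valid positive changeset for a subforest `C` and `X` is a
tree cap rooted at `u`, then `X` consists of exactly all non-cached nodes of the
subtree `T(u)`. -/
theorem tree_cap_positive_changeset_eq {V : Type} [Fintype V] [DecidableEq V]
    (T : RTree V) (C X : Set V) (u : V)
    (hC : T.Subforest C) (hX : T.ValidPos C X) (hcap : T.TreeCap u X) :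
    X = T.subtree u \ C := by
  obtain ⟨-, hdisj, hforest⟩ := hX
  obtain ⟨hsub, hu, -⟩ := hcap
  ext v
  refine ⟨fun hv => ⟨hsub hv, fun hvC => ?_⟩, fun ⟨hv, hvC⟩ => ?_⟩
  · exact Set.notMem_empty v (hdisj ▸ ⟨hv, hvC⟩)
  · exact (hforest u (Or.inr hu) hv).resolve_left hvC
end
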